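/- For every integer n ≥ 0, the following identity holds in ℤ[q,t,r]: Σ_{σ∈S_n} q^{maj(σ)} t^{exc(σ)} r^{fix(σ)} = Σ_{m=0}^{⌊n/2⌋} (tq)^m Σ_{(k_0,k_1,…,k_m)} [n choose k_0,…,k_m]_q · r^{k_0} · Π_{i=1}^{m} [k_i − 1]_{tq}, where the inner sum is over all ordered tuples (k_0,k_1,…,k_m) of integers with k_0 ≥ 0, k_1,…,k_m ≥ 2 and k_0+k_1+⋯+k_m = n. -/

import Mathlib

/-!
STATEMENT 1: For every integer n ≥ 0, in ℤ[q,t,r]: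
Σ_{σ∈S_n} q^{maj σ} t^{exc σ} r^{fix σ}
  = Σ_{m=0}^{⌊n/2⌋} (tq)^m Σ_{(k_0,…,k_m)} [n choose k_0,…,k_m]_q · r^{k_0} · Π_{i=1}^m [k_i−1]_{tq},
the inner sum over tuples with k_0 ≥ 0, k_1,…,k_m ≥ 2, Σ k_i = n.
We work in the fraction field of ℤ[q,t,r], where the q-multinomial coefficient can be
written directly as [n]_q!/([k_0]_q!⋯[k_m]_q!); since ℤ[q,t,r] embeds in its fraction
field this is equivalent to the identity in ℤ[q,t,r].
-/

noncomputable section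

/-- The one-line value `σ(i)` of a permutation of `[n] = {1,…,n}` (1-based), extended
to all of `ℕ` by the identity outside `[n]`. -/
def pv {n : ℕ} (σ : Equiv.Perm (Fin n)) (i : ℕ) : ℕ :=
  if h : 1 ≤ i ∧ i ≤ n then ((σ ⟨i - 1, by omega⟩ : Fin n) : ℕ) + 1 else i

/-- The descent set `Des(σ) = {i ∈ [n-1] : σ(i) > σ(i+1)}`. -/
def DesSet {n : ℕ} (σ : Equiv.Perm (Fin n)) : Finset ℕ :=
  (Finset.Icc 1 (n - 1)).filter fun i => pv σ (i + 1) < pv σ i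

/-- The major index `maj(σ) = Σ_{i ∈ Des(σ)} i`. -/
def maj {n : ℕ} (σ : Equiv.Perm (Fin n)) : ℕ := ∑ i ∈ DesSet σ, i

/-- The excedance set `Exc(σ) = {i ∈ [n-1] : σ(i) > i}`. -/
def ExcSet {n : ℕ} (σ : Equiv.Perm (Fin n)) : Finset ℕ :=
  (Finset.Icc 1 (n - 1)).filter fun i => i < pv σ i

/-- The excedance number `exc(σ) = |Exc(σ)|`. -/
def exc {n : ℕ} (σ : Equiv.Perm (Fin n)) : ℕ := (ExcSet σ).card

/-- The number of fixed points `fix(σ) = |{i ∈ [n] : σ(i) = i}|`. -/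
def fixStat {n : ℕ} (σ : Equiv.Perm (Fin n)) : ℕ :=
  ((Finset.Icc 1 n).filter fun i => pv σ i = i).card

/-- The field of rational functions in three variables `q = X 0`, `t = X 1`, `r = X 2`
over `ℤ`. -/
abbrev K : Type := FractionRing (MvPolynomial (Fin 3) ℤ)

/-- The variable `q`. -/
def qv : K := algebraMap (MvPolynomial (Fin 3) ℤ) K (MvPolynomial.X 0)

/-- The variable `t`. -/
def tv : K := algebraMap (MvPolynomial (Fin 3) ℤ) K (MvPolynomial.X 1)

/-- The variable `r`. -/
def rv : K := algebraMap (MvPolynomial (Fin 3) ℤ) K (MvPolynomial.X 2)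

/-- `[k]_x = 1 + x + ⋯ + x^{k-1}`. -/
def qInt (x : K) (k : ℕ) : K := ∑ i ∈ Finset.range k, x ^ i

/-- `[n]_x! = [n]_x [n-1]_x ⋯ [1]_x`. -/
def qFact (x : K) (n : ℕ) : K := ∏ k ∈ Finset.range n, qInt x (k + 1)

/-- The q-multinomial coefficient `[n choose k_0,…,k_m]_q = [n]_q!/([k_0]_q!⋯[k_m]_q!)`,
for a tuple `k : Fin (m+1) → ℕ`. -/
def qMultinomial {m : ℕ} (n : ℕ) (k : Fin (m + 1) → ℕ) : K :=
  qFact qv n / ∏ i : Fin (m + 1), qFact qv (k i)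

section GradedSum

open PowerSeries

variable {F : Type*} [Field F]

/-- The formal sum `∑ₖ zᵏ f k` of a sequence of power series in `z`. -/
def gradedSum (f : ℕ → F⟦X⟧) : F⟦X⟧ :=
  PowerSeries.mk fun n => ∑ p ∈ Finset.HasAntidiagonal.antidiagonal n, coeff p.2 (f p.1)

theorem coeff_gradedSum (f : ℕ → F⟦X⟧) {n N : ℕ} (h : n ≤ N) :
    coeff n (gradedSum f) = coeff n (∑ k ∈ Finset.range (N + 1), X ^ k * f k) := by
  rw [gradedSum, coeff_mk, map_sum, Finset.Nat.sum_antidiagonal_eq_sum_range_succ_mk]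
  have hsub : Finset.range (n + 1) ⊆ Finset.range (N + 1) := by
    intro x; simp only [Finset.mem_range]; omega
  rw [← Finset.sum_subset hsub]
  · refine Finset.sum_congr rfl fun k hk => ?_
    rw [coeff_X_pow_mul', if_pos (by simpa [Nat.lt_succ_iff] using hk)]
  · intro k _ hk
    rw [coeff_X_pow_mul', if_neg (by simpa [Nat.lt_succ_iff] using hk)]

theorem gradedSum_mul_left (w : F⟦X⟧) (f : ℕ → F⟦X⟧) :
    gradedSum (fun k => w * f k) = w * gradedSum f := by
  ext n
  rw [coeff_gradedSum _ le_rfl, coeff_mul]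
  have : ∀ p ∈ Finset.HasAntidiagonal.antidiagonal n, coeff p.1 w * coeff p.2 (gradedSum f) =
      coeff p.1 w * coeff p.2 (∑ k ∈ Finset.range (n + 1), X ^ k * f k) := by
    intro p hp
    have hle : p.2 ≤ n := by
      have := Finset.HasAntidiagonal.mem_antidiagonal.1 hp
      omega
    rw [coeff_gradedSum f hle]
  rw [Finset.sum_congr rfl this, ← coeff_mul, Finset.mul_sum]
  congr 1
  exact Finset.sum_congr rfl fun k _ => by ring

theorem gradedSum_add (f g : ℕ → F⟦X⟧) :
    gradedSum (fun k => f k + g k) = gradedSum f + gradedSum g := by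
  ext n
  simp [gradedSum, Finset.sum_add_distrib]

theorem gradedSum_sum {ι : Type*} (s : Finset ι) (f : ι → ℕ → F⟦X⟧) :
    gradedSum (fun k => ∑ i ∈ s, f i k) = ∑ i ∈ s, gradedSum (f i) := by
  ext n
  simp only [gradedSum, coeff_mk, map_sum]
  rw [Finset.sum_comm]

theorem gradedSum_succ (f : ℕ → F⟦X⟧) :
    gradedSum f = f 0 + X * gradedSum (fun k => f (k + 1)) := by
  ext n
  cases n with
  | zero => simp [gradedSum]
  | succ n =>
    rw [map_add, coeff_succ_X_mul, gradedSum, coeff_mk, gradedSum, coeff_mk,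
      Finset.Nat.antidiagonal_succ]
    simp

/-- The difference `f k - f (k - 1)`, with `f (-1) = 0`. -/
def backDiff {A : Type*} [AddGroup A] (f : ℕ → A) : ℕ → A
  | 0 => f 0
  | k + 1 => f (k + 1) - f k

theorem gradedSum_backDiff (y : F⟦X⟧) (f : ℕ → F⟦X⟧) :
    gradedSum (fun k => y ^ k * backDiff f k) = (1 - X * y) * gradedSum (fun k => y ^ k * f k) := by
  have h1 : gradedSum (fun k => y ^ k * backDiff f k) + X * y * gradedSum (fun k => y ^ k * f k) =
      gradedSum (fun k => y ^ k * f k) := by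
    rw [gradedSum_succ, gradedSum_succ (fun k => y ^ k * f k)]
    rw [add_assoc, mul_assoc X y, ← mul_add X]
    congr 2
    rw [← gradedSum_succ (fun k => y ^ k * f k), ← gradedSum_mul_left, ← gradedSum_add]
    congr 1
    funext k
    simp only [backDiff]
    ring
  linear_combination h1

theorem gradedSum_choose_add (w : F⟦X⟧) (h : ℕ) :
    gradedSum (fun k => ((h + k).choose k : F⟦X⟧) * w ^ k) * (1 - X * w) ^ (h + 1) = 1 := by
  induction h with
  | zero =>
    have := gradedSum_succ (fun k => ((0 + k).choose k : F⟦X⟧) * w ^ k)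
    have h2 : gradedSum (fun k => ((0 + (k + 1)).choose (k + 1) : F⟦X⟧) * w ^ (k + 1)) =
        w * gradedSum (fun k => ((0 + k).choose k : F⟦X⟧) * w ^ k) := by
      rw [← gradedSum_mul_left]
      congr 1
      funext k
      simp [pow_succ']
    rw [h2] at this
    simp only [Nat.choose_zero_right, pow_zero, Nat.cast_one, mul_one] at this
    linear_combination this
  | succ h ih =>
    have h1 := gradedSum_succ (fun k => ((h + 1 + k).choose k : F⟦X⟧) * w ^ k)
    have h3 := gradedSum_succ (fun k => ((h + k).choose k : F⟦X⟧) * w ^ k)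
    have h2 : gradedSum (fun k => ((h + 1 + (k + 1)).choose (k + 1) : F⟦X⟧) * w ^ (k + 1)) =
        w * gradedSum (fun k => ((h + 1 + k).choose k : F⟦X⟧) * w ^ k) +
        gradedSum (fun k => ((h + (k + 1)).choose (k + 1) : F⟦X⟧) * w ^ (k + 1)) := by
      rw [← gradedSum_mul_left, ← gradedSum_add]
      congr 1
      funext k
      rw [show h + 1 + (k + 1) = (h + 1 + k) + 1 by ring, Nat.choose_succ_succ,
        show h + 1 + k = h + (k + 1) by ring]
      push_cast
      ring
    rw [h2] at h1
    simp only [Nat.choose_zero_right, pow_zero, Nat.cast_one, mul_one] at h1 h3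
    have h4 : gradedSum (fun k => ((h + 1 + k).choose k : F⟦X⟧) * w ^ k) * (1 - X * w) =
      gradedSum (fun k => ((h + k).choose k : F⟦X⟧) * w ^ k) := by linear_combination h1 - h3
    rw [pow_succ' _ (h + 1), ← mul_assoc, h4, ih]

theorem gradedSum_choose (w : F⟦X⟧) (i : ℕ) :
    gradedSum (fun k => (k.choose i : F⟦X⟧) * w ^ k) * (1 - X * w) ^ (i + 1) = (X * w) ^ i := by
  induction i with
  | zero => simpa using gradedSum_choose_add w 0
  | succ i ih =>
    have h1 := gradedSum_succ (fun k => (k.choose (i + 1) : F⟦X⟧) * w ^ k)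
    have h2 : gradedSum (fun k => ((k + 1).choose (i + 1) : F⟦X⟧) * w ^ (k + 1)) =
        w * (gradedSum (fun k => (k.choose i : F⟦X⟧) * w ^ k) +
        gradedSum (fun k => (k.choose (i + 1) : F⟦X⟧) * w ^ k)) := by
      rw [← gradedSum_add, ← gradedSum_mul_left]
      congr 1
      funext k
      rw [Nat.choose_succ_succ]
      push_cast
      ring
    rw [h2] at h1
    simp only [Nat.choose_zero_succ, Nat.cast_zero, zero_mul, zero_add] at h1
    rw [pow_succ _ i, ← ih]
    rw [pow_succ _ (i + 1)]
    linear_combination (1 - X * w) ^ (i + 1) * h1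

theorem gradedSum_excedance_step {g v u y : F⟦X⟧} (hu : u * (1 - X * y * (1 + v)) = 1) (h : ℕ) :
    gradedSum (fun k => y ^ k * backDiff (fun k => ((h + k).choose k : F⟦X⟧) *
      ∑ j ∈ Finset.range (k + 1), (k.choose j : F⟦X⟧) * (g * v ^ (h + j))) k) =
      (g * (1 - X * y) * u) * (v * u) ^ h := by
  rw [gradedSum_backDiff]
  have h1 : (fun k => y ^ k * (((h + k).choose k : F⟦X⟧) *
      ∑ j ∈ Finset.range (k + 1), (k.choose j : F⟦X⟧) * (g * v ^ (h + j)))) =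
      fun k => (g * v ^ h) * (((h + k).choose k : F⟦X⟧) * (y * (1 + v)) ^ k) := by
    funext k
    have : ∑ j ∈ Finset.range (k + 1), (k.choose j : F⟦X⟧) * (g * v ^ (h + j)) =
        g * v ^ h * (1 + v) ^ k := by
      rw [add_comm 1 v, add_pow, Finset.mul_sum]
      refine Finset.sum_congr rfl fun j _ => ?_
      rw [pow_add]; ring
    rw [this, mul_pow]; ring
  rw [h1, gradedSum_mul_left]
  have h2 := gradedSum_choose_add (y * (1 + v)) h
  have h3 : u ^ (h + 1) * (1 - X * (y * (1 + v))) ^ (h + 1) = 1 := by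
    rw [← mul_pow, ← mul_assoc X, hu, one_pow]
  have h4 : gradedSum (fun k => ((h + k).choose k : F⟦X⟧) * (y * (1 + v)) ^ k) = u ^ (h + 1) := by
    linear_combination u ^ (h + 1) * h2 -
      gradedSum (fun k => ((h + k).choose k : F⟦X⟧) * (y * (1 + v)) ^ k) * h3
  rw [h4, mul_pow]; ring

theorem gradedSum_antiexcedance_step {g v u y : F⟦X⟧} (hu : u * (1 - X * y) = 1) (h : ℕ) :
    gradedSum (fun k => y ^ k * backDiff (fun k => ∑ i ∈ Finset.range (h + 1),
      (h.choose i : F⟦X⟧) * (k.choose i : F⟦X⟧) *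
      ∑ j ∈ Finset.range (i + 1), (i.choose j : F⟦X⟧) * (g * v ^ (h - i + j))) k) =
      g * ((v + X * y) * u) ^ h := by
  rw [gradedSum_backDiff]
  have h1 : (fun k => y ^ k * (∑ i ∈ Finset.range (h + 1),
      (h.choose i : F⟦X⟧) * (k.choose i : F⟦X⟧) *
      ∑ j ∈ Finset.range (i + 1), (i.choose j : F⟦X⟧) * (g * v ^ (h - i + j)))) =
      fun k => ∑ i ∈ Finset.range (h + 1), (h.choose i * g * v ^ (h - i) * (1 + v) ^ i) *
        ((k.choose i : F⟦X⟧) * y ^ k) := by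
    funext k
    rw [Finset.mul_sum]
    refine Finset.sum_congr rfl fun i _ => ?_
    have : ∑ j ∈ Finset.range (i + 1), (i.choose j : F⟦X⟧) * (g * v ^ (h - i + j)) =
        g * v ^ (h - i) * (1 + v) ^ i := by
      rw [add_comm 1 v, add_pow, Finset.mul_sum]
      refine Finset.sum_congr rfl fun j _ => ?_
      rw [pow_add]; ring
    rw [this]; ring
  rw [h1, gradedSum_sum]
  have h4 : ∀ i, gradedSum (fun k => (k.choose i : F⟦X⟧) * y ^ k) = (X * y) ^ i * u ^ (i + 1) := by
    intro i
    have h3 : u ^ (i + 1) * (1 - X * y) ^ (i + 1) = 1 := by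
      rw [← mul_pow, hu, one_pow]
    linear_combination u ^ (i + 1) * gradedSum_choose y i -
      gradedSum (fun k => (k.choose i : F⟦X⟧) * y ^ k) * h3
  simp only [gradedSum_mul_left, h4]
  have h5 : (v + X * y) * u = (X * y * (1 + v) * u) + v := by linear_combination v * hu
  rw [h5, add_pow, Finset.mul_sum, Finset.mul_sum]
  refine Finset.sum_congr rfl fun i _ => ?_
  simp only [mul_pow, pow_succ]
  linear_combination (h.choose i * g * v ^ (h - i) * (1 + v) ^ i) * X ^ i * y ^ i * u ^ i * hu

theorem gradedSum_fixed_step {g u y : F⟦X⟧} (hu : u * (1 - X * y) = 1) :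
    gradedSum (fun k => y ^ k * g) = g * u := by
  have h2 := gradedSum_choose_add y 0
  simp only [zero_add, Nat.choose_self, Nat.cast_one, one_mul, pow_one] at h2
  have : (fun k => y ^ k * g) = fun k => g * y ^ k := by funext k; ring
  rw [this, gradedSum_mul_left]
  linear_combination g * u * h2 - g * gradedSum (fun k => y ^ k) * hu

end GradedSum
section SlotCount

/-- One step of the recursion for `slotCount`: insertion of `k` copies of a letter of type `o`. -/
def slotStep {A : Type*} [AddCommGroup A] (o : Ordering) (T : ℕ → A) (h : ℕ) : ℕ → A :=
  match o with
  | .gt => backDiff fun k => (h + k).choose k •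
      ∑ j ∈ Finset.range (k + 1), k.choose j • T (h + j)
  | .lt => backDiff fun k => ∑ i ∈ Finset.range (h + 1), (h.choose i * k.choose i) •
      ∑ j ∈ Finset.range (i + 1), i.choose j • T (h - i + j)
  | .eq => fun _ => T h

theorem map_backDiff {A B : Type*} [AddGroup A] [AddGroup B] (f : A →+ B) (g : ℕ → A) (k : ℕ) :
    f (backDiff g k) = backDiff (fun k => f (g k)) k := by
  cases k <;> simp [backDiff]

theorem map_slotStep {A B : Type*} [AddCommGroup A] [AddCommGroup B] (f : A →+ B) (o : Ordering)
    (T : ℕ → A) (h k : ℕ) : f (slotStep o T h k) = slotStep o (fun h => f (T h)) h k := by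
  cases o <;> simp only [slotStep, map_backDiff, map_sum, map_nsmul]

section Functional

variable {R A : Type*} [CommRing R] [CommRing A] [Algebra (Polynomial R) A]
  (L : A →ₗ[Polynomial R] Polynomial R) (V : A) (T : ℕ → ℤ) (w : R)

theorem coeff_functional_gt (w' : Polynomial R) (hw : w' = Polynomial.C w + Polynomial.X)
    (hL : ∀ a, L (V ^ a) = T a * w' ^ a) (h k : ℕ) :
    (L (V ^ h * (algebraMap (Polynomial R) A w' + V) ^ k)).coeff k =
      (((h + k).choose k * ∑ j ∈ Finset.range (k + 1), k.choose j * T (h + j) : ℤ) : R) * w ^ h := by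
  have h1 : V ^ h * (algebraMap (Polynomial R) A w' + V) ^ k =
      ∑ j ∈ Finset.range (k + 1), ((k.choose j : Polynomial R) * w' ^ (k - j)) • V ^ (h + j) := by
    rw [add_comm _ V, add_pow, Finset.mul_sum]
    refine Finset.sum_congr rfl fun j _ => ?_
    rw [Algebra.smul_def, map_mul, map_pow, map_natCast, pow_add]; ring
  have h2 : L (V ^ h * (algebraMap (Polynomial R) A w' + V) ^ k) =
      Polynomial.C ((∑ j ∈ Finset.range (k + 1), k.choose j * T (h + j) : ℤ) : R) *
        w' ^ (h + k) := by
    rw [h1, map_sum]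
    push_cast
    rw [map_sum, Finset.sum_mul]
    refine Finset.sum_congr rfl fun j hj => ?_
    have hj' : h + k = (k - j) + (h + j) := by
      have := Finset.mem_range.1 hj
      omega
    rw [map_smul, hL, hj', pow_add, smul_eq_mul]
    simp only [map_mul, map_natCast, map_intCast]
    ring
  rw [h2, Polynomial.coeff_C_mul, hw, add_comm (Polynomial.C w), Polynomial.coeff_X_add_C_pow]
  simp only [Nat.add_sub_cancel]
  push_cast
  ring

variable (hL : ∀ a, L (V ^ a) = T a * Polynomial.C w ^ a)
include hL

theorem functional_const (a j : ℕ) :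
    L (V ^ a * (algebraMap (Polynomial R) A (Polynomial.C w) + V) ^ j) =
      Polynomial.C (((∑ l ∈ Finset.range (j + 1), j.choose l * T (a + l) : ℤ) : R) *
        w ^ (a + j)) := by
  have h1 : V ^ a * (algebraMap (Polynomial R) A (Polynomial.C w) + V) ^ j =
      ∑ l ∈ Finset.range (j + 1),
        ((j.choose l : Polynomial R) * Polynomial.C w ^ (j - l)) • V ^ (a + l) := by
    rw [add_comm _ V, add_pow, Finset.mul_sum]
    refine Finset.sum_congr rfl fun l _ => ?_
    rw [Algebra.smul_def, map_mul, map_pow, map_natCast, pow_add]; ring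
  rw [h1, map_sum, map_mul, map_pow]
  push_cast
  rw [map_sum, Finset.sum_mul]
  refine Finset.sum_congr rfl fun l hl => ?_
  have hj' : a + j = (j - l) + (a + l) := by
    have := Finset.mem_range.1 hl
    omega
  rw [map_smul, hL, hj', pow_add, smul_eq_mul]
  simp only [map_mul, map_natCast, map_intCast]
  ring

theorem coeff_functional_lt (h k : ℕ) :
    (L ((algebraMap (Polynomial R) A Polynomial.X + V) ^ h *
      (algebraMap (Polynomial R) A Polynomial.X +
        (algebraMap (Polynomial R) A (Polynomial.C w) + V)) ^ k)).coeff k =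
      ((∑ i ∈ Finset.range (h + 1), h.choose i * k.choose i *
        ∑ j ∈ Finset.range (i + 1), i.choose j * T (h - i + j) : ℤ) : R) * w ^ h := by
  have h1 : (algebraMap (Polynomial R) A Polynomial.X + V) ^ h *
      (algebraMap (Polynomial R) A Polynomial.X +
        (algebraMap (Polynomial R) A (Polynomial.C w) + V)) ^ k =
      ∑ i ∈ Finset.range (h + 1), ∑ j ∈ Finset.range (k + 1),
        ((h.choose i * k.choose j : Polynomial R) * Polynomial.X ^ (i + (k - j))) •
          (V ^ (h - i) * (algebraMap (Polynomial R) A (Polynomial.C w) + V) ^ j) := by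
    rw [add_pow, add_comm _ (algebraMap (Polynomial R) A (Polynomial.C w) + V), add_pow,
      Finset.sum_mul_sum]
    refine Finset.sum_congr rfl fun i _ => Finset.sum_congr rfl fun j _ => ?_
    rw [Algebra.smul_def, map_mul, map_mul, map_pow, map_natCast, map_natCast, pow_add]; ring
  rw [h1, map_sum, Polynomial.finsetSum_coeff]
  push_cast
  rw [Finset.sum_mul]
  refine Finset.sum_congr rfl fun i hi => ?_
  rw [map_sum, Polynomial.finsetSum_coeff]
  have hterm : ∀ j ∈ Finset.range (k + 1),
      (L (((h.choose i * k.choose j : Polynomial R) * Polynomial.X ^ (i + (k - j))) •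
          (V ^ (h - i) * (algebraMap (Polynomial R) A (Polynomial.C w) + V) ^ j))).coeff k =
      if j = i then (h.choose i : R) * k.choose i *
        (∑ j ∈ Finset.range (i + 1), (i.choose j : R) * (T (h - i + j) : R)) * w ^ h else 0 := by
    intro j hj
    rw [map_smul, functional_const L V T w hL, smul_eq_mul]
    have e1 : ∀ c : R, (h.choose i * k.choose j : Polynomial R) * Polynomial.X ^ (i + (k - j)) *
        Polynomial.C c = Polynomial.C (h.choose i * k.choose j * c) *
          Polynomial.X ^ (i + (k - j)) := by
      intro c
      simp only [map_mul, map_natCast]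
      ring
    rw [e1, Polynomial.coeff_C_mul_X_pow]
    have hi' := Finset.mem_range.1 hi
    have hj' := Finset.mem_range.1 hj
    by_cases hij : j = i
    · subst hij
      rw [if_pos (by omega), if_pos rfl, show h - j + j = h by omega]
      push_cast
      ring
    · rw [if_neg (by omega), if_neg hij]
  rw [Finset.sum_congr rfl hterm, Finset.sum_ite_eq']
  split_ifs with hmem
  · rfl
  · have : k.choose i = 0 := Nat.choose_eq_zero_of_lt (by simpa [Nat.lt_succ_iff] using hmem)
    simp [this]

theorem coeff_functional_eq (h k : ℕ) :
    (L (V ^ h * (algebraMap (Polynomial R) A Polynomial.X +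
        (algebraMap (Polynomial R) A (Polynomial.C w) + V)) ^ k)).coeff k = (T h : R) * w ^ h := by
  have h1 : V ^ h * (algebraMap (Polynomial R) A Polynomial.X +
        (algebraMap (Polynomial R) A (Polynomial.C w) + V)) ^ k =
      ∑ j ∈ Finset.range (k + 1),
        ((k.choose j : Polynomial R) * Polynomial.X ^ (k - j)) •
          (V ^ h * (algebraMap (Polynomial R) A (Polynomial.C w) + V) ^ j) := by
    rw [add_comm _ (algebraMap (Polynomial R) A (Polynomial.C w) + V), add_pow, Finset.mul_sum]
    refine Finset.sum_congr rfl fun j _ => ?_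
    rw [Algebra.smul_def, map_mul, map_pow, map_natCast]; ring
  rw [h1, map_sum, Polynomial.finsetSum_coeff]
  rw [Finset.sum_eq_single_of_mem 0 (by simp)]
  · rw [map_smul, functional_const L V T w hL, smul_eq_mul]
    rw [Nat.choose_zero_right, Nat.cast_one, one_mul, Nat.sub_zero, Polynomial.coeff_mul_C,
      Polynomial.coeff_X_pow_self]
    simp
  · intro j hj hj0
    rw [map_smul, functional_const L V T w hL, smul_eq_mul]
    have e1 : ∀ c : R, (k.choose j : Polynomial R) * Polynomial.X ^ (k - j) *
        Polynomial.C c = Polynomial.C (k.choose j * c) * Polynomial.X ^ (k - j) := by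
      intro c
      simp only [map_mul, map_natCast]
      ring
    have hj' := Finset.mem_range.1 hj
    rw [e1, Polynomial.coeff_C_mul_X_pow, if_neg (by omega)]

end Functional

/-- The number of ways to fill the slots of a word with `c l` letters equal to `l`,
where `s l` is the type of the letter `l`, with `h` additional factors. -/
def slotCount : {M : ℕ} → (Fin M → Ordering) → (Fin M → ℕ) → ℕ → ℤ
  | 0, _, _, h => 0 ^ h
  | _ + 1, s, c, h => slotStep (s 0) (slotCount (Fin.tail s) (Fin.tail c)) h (c 0)

/-- Whether a letter of type `o` that fills the slots `a, …, b - 1` of the sorted word may occur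
at position `p`. -/
def allowed (o : Ordering) (a b p : ℕ) : Prop :=
  match o with
  | .lt => p < a ∨ p + 1 < b
  | .eq => a ≤ p ∧ p < b
  | .gt => b ≤ p ∨ a < p

instance (o : Ordering) (a b p : ℕ) : Decidable (allowed o a b p) := by
  cases o <;> unfold allowed <;> infer_instance

/-- The number of letters smaller than `l` in a word with content `c`. -/
def startPos {M : ℕ} (c : Fin M → ℕ) (l : Fin M) : ℕ := ∑ i : Fin M, if i < l then c i else 0

section Forms

variable {A : Type*} [CommRing A] {M : ℕ}

/-- The sum of the variables of type `lt`. -/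
def ltSum (s : Fin M → Ordering) (x : Fin M → A) : A := ∑ l, if s l = .lt then x l else 0

/-- The sum of `w` and of the letters that may occur at position `p`. -/
def slotForm (s : Fin M → Ordering) (c : Fin M → ℕ) (w : A) (x : Fin M → A) (p : ℕ) : A :=
  w + ∑ l, if allowed (s l) (startPos c l) (startPos c l + c l) p then x l else 0

/-- The product of the slot forms over all positions. -/
def slotProd (s : Fin M → Ordering) (c : Fin M → ℕ) (w : A) (x : Fin M → A) : A :=
  ∏ p ∈ Finset.range (∑ l, c l), slotForm s c w x p

theorem startPos_zero (c : Fin (M + 1) → ℕ) : startPos c 0 = 0 := by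
  simp [startPos]

theorem startPos_succ (c : Fin (M + 1) → ℕ) (l : Fin M) :
    startPos c l.succ = c 0 + startPos (Fin.tail c) l := by
  simp [startPos, Fin.sum_univ_succ, Fin.tail, Fin.succ_lt_succ_iff]

theorem ltSum_succ (s : Fin (M + 1) → Ordering) (x : Fin (M + 1) → A) :
    ltSum s x = (if s 0 = .lt then x 0 else 0) + ltSum (Fin.tail s) (Fin.tail x) := by
  simp [ltSum, Fin.sum_univ_succ, Fin.tail]
  rfl

theorem slotForm_add (s : Fin (M + 1) → Ordering) (c : Fin (M + 1) → ℕ) (w : A)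
    (x : Fin (M + 1) → A) (p : ℕ) :
    slotForm s c w x (c 0 + p) = slotForm (Fin.tail s) (Fin.tail c)
      (w + if s 0 = .gt then x 0 else 0) (Fin.tail x) p := by
  rw [slotForm, slotForm, Fin.sum_univ_succ, ← add_assoc]
  congr 2
  · congr 1
    rw [startPos_zero]
    rcases s 0 with _ | _ | _ <;> simp [allowed]
    omega
  · funext l
    congr 1
    rw [startPos_succ]
    simp only [Fin.tail]
    rcases s l.succ with _ | _ | _ <;> simp only [allowed, eq_iff_iff] <;> omega

theorem slotForm_of_lt (s : Fin (M + 1) → Ordering) (c : Fin (M + 1) → ℕ) (w : A)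
    (x : Fin (M + 1) → A) {p : ℕ} (hp : p < c 0) :
    slotForm s c w x p = w + (if allowed (s 0) 0 (c 0) p then x 0 else 0) +
      ltSum (Fin.tail s) (Fin.tail x) := by
  rw [slotForm, Fin.sum_univ_succ, ← add_assoc, ltSum]
  congr 2
  · rw [startPos_zero, zero_add]
  · funext l
    congr 1
    rw [startPos_succ]
    simp only [Fin.tail]
    rcases s l.succ with _ | _ | _ <;> simp [allowed] <;> omega

theorem slotProd_succ (s : Fin (M + 1) → Ordering) (c : Fin (M + 1) → ℕ) (w : A)
    (x : Fin (M + 1) → A) :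
    slotProd s c w x = (∏ p ∈ Finset.range (c 0), (w + (if allowed (s 0) 0 (c 0) p then x 0 else 0) +
      ltSum (Fin.tail s) (Fin.tail x))) * slotProd (Fin.tail s) (Fin.tail c)
        (w + if s 0 = .gt then x 0 else 0) (Fin.tail x) := by
  rw [slotProd, Fin.sum_univ_succ, Finset.prod_range_add]
  congr 1
  · exact Finset.prod_congr rfl fun p hp => slotForm_of_lt s c w x (Finset.mem_range.1 hp)
  · exact Finset.prod_congr rfl fun p _ => slotForm_add s c w x p

theorem map_slotProd {B : Type*} [CommRing B] (f : A →+* B) (s : Fin M → Ordering)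
    (c : Fin M → ℕ) (w : A) (x : Fin M → A) :
    f (slotProd s c w x) = slotProd s c (f w) (f ∘ x) := by
  simp only [slotProd, slotForm, map_prod, map_add, map_sum, apply_ite f, map_zero,
    Function.comp_apply]

theorem map_ltSum {B : Type*} [CommRing B] (f : A →+* B) (s : Fin M → Ordering)
    (x : Fin M → A) : f (ltSum s x) = ltSum s (f ∘ x) := by
  simp only [ltSum, map_sum, apply_ite f, map_zero, Function.comp_apply]

theorem prod_allowed_eq (w x v : A) (k : ℕ) :
    ∏ p ∈ Finset.range k, (w + (if allowed .eq 0 k p then x else 0) + v) = (x + (w + v)) ^ k := by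
  rw [Finset.prod_congr rfl (g := fun _ => x + (w + v)), Finset.prod_const, Finset.card_range]
  intro p hp
  rw [if_pos ⟨Nat.zero_le _, Finset.mem_range.1 hp⟩]
  ring

theorem prod_allowed_gt (w x v : A) (k : ℕ) :
    ∏ p ∈ Finset.range (k + 1), (w + (if allowed .gt 0 (k + 1) p then x else 0) + v) =
      (w + x + v) ^ (k + 1) - x * (w + x + v) ^ k := by
  rw [Finset.prod_range_succ', Finset.prod_congr rfl (g := fun _ => w + x + v), Finset.prod_const,
    Finset.card_range]
  · simp only [allowed, lt_irrefl, or_false, Nat.le_zero, Nat.add_eq_zero_iff, one_ne_zero,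
      and_false, if_false]
    ring
  · intro p _
    rw [if_pos (show allowed .gt 0 (k + 1) (p + 1) from Or.inr p.succ_pos)]

theorem prod_allowed_lt (w x v : A) (k : ℕ) :
    ∏ p ∈ Finset.range (k + 1), (w + (if allowed .lt 0 (k + 1) p then x else 0) + v) =
      (x + (w + v)) ^ (k + 1) - x * (x + (w + v)) ^ k := by
  rw [Finset.prod_range_succ, Finset.prod_congr rfl (g := fun _ => x + (w + v)), Finset.prod_const,
    Finset.card_range]
  · simp only [allowed, lt_irrefl, or_false, Nat.not_lt_zero, if_false]
    ring
  · intro p hp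
    have := Finset.mem_range.1 hp
    rw [if_pos (show allowed .lt 0 (k + 1) p from Or.inr (by omega))]
    ring

end Forms

section Expand

variable (R : Type*) [CommRing R] (M : ℕ)

/-- Separation of the first variable of a multivariate polynomial, into the coefficients. -/
def expandHom : MvPolynomial (Fin (M + 1)) R →+* MvPolynomial (Fin M) (Polynomial R) :=
  MvPolynomial.eval₂Hom (MvPolynomial.C.comp Polynomial.C)
    (Fin.cons (MvPolynomial.C Polynomial.X) MvPolynomial.X)

theorem coeff_expandHom (f : MvPolynomial (Fin (M + 1)) R) (c : Fin (M + 1) → ℕ) :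
    (MvPolynomial.coeff (Finsupp.equivFunOnFinite.symm (Fin.tail c)) (expandHom R M f)).coeff (c 0) =
      MvPolynomial.coeff (Finsupp.equivFunOnFinite.symm c) f := by
  induction f using MvPolynomial.induction_on' with
  | add p q hp hq => simp only [map_add, MvPolynomial.coeff_add, Polynomial.coeff_add, hp, hq]
  | monomial d a =>
    have h1 : expandHom R M (MvPolynomial.monomial d a) =
        MvPolynomial.monomial (Finsupp.equivFunOnFinite.symm (Fin.tail d))
          (Polynomial.monomial (d 0) a) := by
      rw [expandHom, MvPolynomial.coe_eval₂Hom, MvPolynomial.eval₂_monomial, MvPolynomial.monomial_eq,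
        Finsupp.prod_fintype _ _ (by simp), Finsupp.prod_fintype _ _ (by simp), Fin.prod_univ_succ,
        ← Polynomial.C_mul_X_pow_eq_monomial]
      simp [Fin.tail, mul_assoc]
    rw [h1, MvPolynomial.coeff_monomial, MvPolynomial.coeff_monomial]
    have h2 : d = Finsupp.equivFunOnFinite.symm c ↔ d 0 = c 0 ∧
        Finsupp.equivFunOnFinite.symm (Fin.tail (d : Fin (M + 1) → ℕ)) =
          Finsupp.equivFunOnFinite.symm (Fin.tail c) := by
      rw [Equiv.apply_eq_iff_eq, Equiv.eq_symm_apply]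
      constructor
      · rintro rfl
        exact ⟨rfl, rfl⟩
      · rintro ⟨h, h'⟩
        funext i
        refine Fin.cases h (fun j => congrFun h' j) i
    by_cases hd : Fin.tail (d : Fin (M + 1) → ℕ) = Fin.tail c
    · rw [if_pos (by rw [hd]), Polynomial.coeff_monomial]
      simp [h2, hd]
    · rw [if_neg (by simpa using hd), if_neg (by simp [h2, hd]), Polynomial.coeff_zero]

theorem expandHom_C (w : R) :
    expandHom R M (MvPolynomial.C w) = MvPolynomial.C (Polynomial.C w) := by
  simp [expandHom]

theorem expandHom_comp_X :
    expandHom R M ∘ MvPolynomial.X = Fin.cons (MvPolynomial.C Polynomial.X) MvPolynomial.X := by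
  funext i
  simp [expandHom]

end Expand

/-- Multiplication by a fixed polynomial, followed by the extraction of a coefficient. -/
def mulCoeff {M : ℕ} {R : Type*} [CommRing R] (c : Fin M → ℕ) (g : MvPolynomial (Fin M) R) :
    MvPolynomial (Fin M) R →ₗ[R] R where
  toFun f := MvPolynomial.coeff (Finsupp.equivFunOnFinite.symm c) (f * g)
  map_add' f f' := by rw [add_mul, MvPolynomial.coeff_add]
  map_smul' a f := by rw [smul_mul_assoc, MvPolynomial.coeff_smul]; rfl

theorem coeff_ltSum_pow_mul_slotProd {M : ℕ} {R : Type*} [CommRing R] (s : Fin M → Ordering)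
    (c : Fin M → ℕ) (w : R) (h : ℕ) :
    MvPolynomial.coeff (Finsupp.equivFunOnFinite.symm c)
      (ltSum s MvPolynomial.X ^ h * slotProd s c (MvPolynomial.C w) MvPolynomial.X) =
      slotCount s c h * w ^ h := by
  induction M generalizing R h with
  | zero =>
    have hc : Finsupp.equivFunOnFinite.symm c = 0 := Subsingleton.elim _ _
    rw [hc]
    rcases h with _ | h <;> simp [ltSum, slotProd, slotCount]
  | succ M ih =>
    rw [← coeff_expandHom, map_mul, map_pow, map_ltSum, map_slotProd, expandHom_comp_X,
      expandHom_C, ltSum_succ, slotProd_succ, Fin.tail_cons, Fin.cons_zero, slotCount]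
    have hL : ∀ (w' : Polynomial R) (a : ℕ),
        mulCoeff (Fin.tail c) (slotProd (Fin.tail s) (Fin.tail c) (MvPolynomial.C w')
          MvPolynomial.X) (ltSum (Fin.tail s) MvPolynomial.X ^ a) =
          slotCount (Fin.tail s) (Fin.tail c) a * w' ^ a := fun w' a => ih _ _ _ _
    have hcoe : ∀ (w' : Polynomial R) (f : MvPolynomial (Fin M) (Polynomial R)),
        MvPolynomial.coeff (Finsupp.equivFunOnFinite.symm (Fin.tail c))
          (f * slotProd (Fin.tail s) (Fin.tail c) (MvPolynomial.C w') MvPolynomial.X) =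
        mulCoeff (Fin.tail c) (slotProd (Fin.tail s) (Fin.tail c) (MvPolynomial.C w')
          MvPolynomial.X) f := fun _ _ => rfl
    generalize hk : c 0 = k
    generalize slotCount (Fin.tail s) (Fin.tail c) = T at hL ⊢
    generalize ltSum (Fin.tail s) (MvPolynomial.X (R := Polynomial R)) = V at hL ⊢
    rcases ho : s 0 with _ | _ | _
    · simp only [if_true, reduceCtorEq, if_false, add_zero]
      rw [← mul_assoc, hcoe]
      specialize hL (Polynomial.C w)
      generalize mulCoeff (Fin.tail c) (slotProd (Fin.tail s) (Fin.tail c)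
        (MvPolynomial.C (Polynomial.C w)) MvPolynomial.X) = L at hL ⊢
      have key := coeff_functional_lt L V T w hL h
      simp only [MvPolynomial.algebraMap_eq] at key
      rcases k with _ | k
      · simp only [slotStep, backDiff, nsmul_eq_mul, Nat.cast_mul]
        rw [← key 0]
        simp
      · simp only [slotStep, backDiff, nsmul_eq_mul, Nat.cast_mul]
        rw [prod_allowed_lt, Int.cast_sub, sub_mul, ← key, ← key, mul_sub, map_sub,
          Polynomial.coeff_sub]
        rw [mul_left_comm _ (MvPolynomial.C Polynomial.X), ← MvPolynomial.smul_eq_C_mul, map_smul, smul_eq_mul,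
          Polynomial.coeff_X_mul]
    · simp only [reduceCtorEq, if_false, add_zero, zero_add]
      rw [← mul_assoc, hcoe, prod_allowed_eq]
      exact coeff_functional_eq _ V T w (hL (Polynomial.C w)) h k
    · simp only [if_true, reduceCtorEq, if_false, zero_add]
      rw [← MvPolynomial.C_add, ← mul_assoc, hcoe]
      specialize hL (Polynomial.C w + Polynomial.X)
      generalize mulCoeff (Fin.tail c) (slotProd (Fin.tail s) (Fin.tail c)
        (MvPolynomial.C (Polynomial.C w + Polynomial.X)) MvPolynomial.X) = L at hL ⊢
      have key := coeff_functional_gt L V T w _ rfl hL h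
      simp only [MvPolynomial.algebraMap_eq] at key
      rcases k with _ | k
      · simp only [slotStep, backDiff, nsmul_eq_mul]
        rw [← key 0]
        simp
      · simp only [slotStep, backDiff, nsmul_eq_mul]
        rw [prod_allowed_gt, Int.cast_sub, sub_mul, ← key, ← key, mul_sub, map_sub,
          Polynomial.coeff_sub, MvPolynomial.C_add]
        rw [mul_left_comm _ (MvPolynomial.C Polynomial.X), ← MvPolynomial.smul_eq_C_mul, map_smul, smul_eq_mul,
          Polynomial.coeff_X_mul]

section Series

open PowerSeries

variable {F : Type*} [Field F] {M : ℕ}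

theorem sum_antidiagonalTuple_succ {A : Type*} [AddCommMonoid A] (n : ℕ)
    (f : (Fin (M + 1) → ℕ) → A) :
    ∑ c ∈ Finset.Nat.antidiagonalTuple (M + 1) n, f c =
      ∑ p ∈ Finset.HasAntidiagonal.antidiagonal n,
        ∑ c ∈ Finset.Nat.antidiagonalTuple M p.2, f (Fin.cons p.1 c) := by
  rw [Finset.sum_sigma']
  refine Finset.sum_bij' (fun c _ => ⟨(c 0, ∑ i, Fin.tail c i), Fin.tail c⟩)
    (fun x _ => Fin.cons x.1.1 x.2) ?_ ?_ ?_ ?_ ?_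
  · intro c hc
    rw [Finset.Nat.mem_antidiagonalTuple, Fin.sum_univ_succ] at hc
    simp [Finset.Nat.mem_antidiagonalTuple, ← hc, Fin.tail]
  · rintro ⟨⟨k, m⟩, c⟩ hx
    simp only [Finset.mem_sigma, Finset.HasAntidiagonal.mem_antidiagonal,
      Finset.Nat.mem_antidiagonalTuple] at hx
    simp [Finset.Nat.mem_antidiagonalTuple, Fin.sum_univ_succ, hx.2, hx.1]
  · intro c _
    simp
  · rintro ⟨⟨k, m⟩, c⟩ hx
    simp only [Finset.mem_sigma, Finset.HasAntidiagonal.mem_antidiagonal,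
      Finset.Nat.mem_antidiagonalTuple] at hx
    simp [hx.2]
  · intro c _
    simp

/-- The generating function of a function on contents, with weights `y`. -/
def contentSeries (y : Fin M → F) : ((Fin M → ℕ) → ℤ) →+ F⟦X⟧ where
  toFun a := PowerSeries.mk fun n => ∑ c ∈ Finset.Nat.antidiagonalTuple M n,
    (∏ i, y i ^ c i) * (a c : F)
  map_zero' := by ext n; simp
  map_add' a b := by ext n; simp [mul_add, Finset.sum_add_distrib]

theorem coeff_contentSeries (y : Fin M → F) (a : (Fin M → ℕ) → ℤ) (n : ℕ) :
    coeff n (contentSeries y a) = ∑ c ∈ Finset.Nat.antidiagonalTuple M n,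
      (∏ i, y i ^ c i) * (a c : F) := by
  simp [contentSeries]

theorem contentSeries_succ (y : Fin (M + 1) → F) (a : (Fin (M + 1) → ℕ) → ℤ) :
    contentSeries y a = gradedSum fun k => C (y 0) ^ k *
      contentSeries (Fin.tail y) fun c => a (Fin.cons k c) := by
  ext n
  rw [coeff_contentSeries, gradedSum, coeff_mk, sum_antidiagonalTuple_succ]
  refine Finset.sum_congr rfl fun p _ => ?_
  rw [← map_pow, coeff_C_mul, coeff_contentSeries, Finset.mul_sum]
  refine Finset.sum_congr rfl fun c _ => ?_
  simp only [Fin.prod_univ_succ, Fin.cons_zero, Fin.cons_succ, Fin.tail]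
  ring

/-- The generating functions of the slot counts. -/
def slotSeries (s : Fin M → Ordering) (y : Fin M → F) (h : ℕ) : F⟦X⟧ :=
  contentSeries y fun c => slotCount s c h

theorem slotSeries_succ (s : Fin (M + 1) → Ordering) (y : Fin (M + 1) → F) (h : ℕ) :
    slotSeries s y h = gradedSum fun k => C (y 0) ^ k *
      slotStep (s 0) (slotSeries (Fin.tail s) (Fin.tail y)) h k := by
  rw [slotSeries, contentSeries_succ]
  congr 1
  funext k
  congr 1
  have h1 : (fun c => slotCount s (Fin.cons k c) h) =
      slotStep (s 0) (fun h c => slotCount (Fin.tail s) c h) h k := by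
    funext c
    have := map_slotStep (Pi.evalAddMonoidHom (fun _ : Fin M → ℕ => ℤ) c) (s 0)
      (fun h c => slotCount (Fin.tail s) c h) h k
    simp only [Pi.evalAddMonoidHom_apply] at this
    rw [this, slotCount, Fin.tail_cons, Fin.cons_zero]
  rw [h1, map_slotStep]
  rfl

theorem slotSeries_zero (s : Fin 0 → Ordering) (y : Fin 0 → F) (h : ℕ) :
    slotSeries s y h = 1 * 0 ^ h := by
  ext n
  rw [slotSeries, coeff_contentSeries]
  rcases n with _ | n <;> rcases h with _ | h <;> simp [slotCount, coeff_one]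

theorem slotSeries_gt {s : Fin (M + 1) → Ordering} {y : Fin (M + 1) → F} {g v u : F⟦X⟧}
    (ih : ∀ h, slotSeries (Fin.tail s) (Fin.tail y) h = g * v ^ h) (hs : s 0 = .gt)
    (hu : u * (1 - X * C (y 0) * (1 + v)) = 1) (h : ℕ) :
    slotSeries s y h = (g * (1 - X * C (y 0)) * u) * (v * u) ^ h := by
  rw [slotSeries_succ, hs, ← gradedSum_excedance_step hu]
  simp only [slotStep, nsmul_eq_mul, ih]

theorem slotSeries_lt {s : Fin (M + 1) → Ordering} {y : Fin (M + 1) → F} {g v u : F⟦X⟧}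
    (ih : ∀ h, slotSeries (Fin.tail s) (Fin.tail y) h = g * v ^ h) (hs : s 0 = .lt)
    (hu : u * (1 - X * C (y 0)) = 1) (h : ℕ) :
    slotSeries s y h = g * ((v + X * C (y 0)) * u) ^ h := by
  rw [slotSeries_succ, hs, ← gradedSum_antiexcedance_step hu]
  simp only [slotStep, nsmul_eq_mul, ih, Nat.cast_mul]

theorem slotSeries_eq {s : Fin (M + 1) → Ordering} {y : Fin (M + 1) → F} {g v u : F⟦X⟧}
    (ih : ∀ h, slotSeries (Fin.tail s) (Fin.tail y) h = g * v ^ h) (hs : s 0 = .eq)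
    (hu : u * (1 - X * C (y 0)) = 1) (h : ℕ) :
    slotSeries s y h = (g * u) * v ^ h := by
  rw [slotSeries_succ, hs]
  simp only [slotStep, ih]
  rw [gradedSum_fixed_step hu]
  ring

end Series

end SlotCount

section Words

theorem lt_card_filter_iff {n : ℕ} {α : Type*} [Preorder α] {f : Fin n → α} (hf : Monotone f)
    {P : α → Prop} [DecidablePred P] (hP : ∀ a b, a ≤ b → P b → P a) (j : Fin n) :
    (j : ℕ) < (Finset.univ.filter fun i => P (f i)).card ↔ P (f j) := by
  constructor
  · intro h
    by_contra hj
    have hsub : (Finset.univ.filter fun i => P (f i)) ⊆ Finset.Iio j := by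
      intro i hi
      rw [Finset.mem_Iio]
      by_contra hij
      exact hj (hP _ _ (hf (not_lt.1 hij)) (Finset.mem_filter.1 hi).2)
    have := Finset.card_le_card hsub
    rw [Fin.card_Iio] at this
    omega
  · intro h
    have hsub : Finset.Iic j ⊆ (Finset.univ.filter fun i => P (f i)) := by
      intro i hi
      exact Finset.mem_filter.2 ⟨Finset.mem_univ _, hP _ _ (hf (Finset.mem_Iic.1 hi)) h⟩
    have := Finset.card_le_card hsub
    rw [Fin.card_Iic] at this
    omega

variable {n M : ℕ}

/-- The number of occurrences of each letter in a word. -/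
def content (w : Fin n → Fin M) (l : Fin M) : ℕ := (Finset.univ.filter fun p => w p = l).card

theorem sum_content (w : Fin n → Fin M) : ∑ l, content w l = n := by
  simp only [content]
  rw [← Finset.card_eq_sum_card_fiberwise (fun _ _ => Finset.mem_coe.2 (Finset.mem_univ _))]
  simp

theorem startPos_content (w : Fin n → Fin M) (l : Fin M) :
    startPos (content w) l = (Finset.univ.filter fun p => w p < l).card := by
  rw [startPos, ← Finset.sum_filter,
    Finset.card_eq_sum_card_fiberwise (f := w) (t := Finset.univ.filter (· < l))]
  · refine Finset.sum_congr rfl fun i hi => ?_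
    rw [content, Finset.filter_filter]
    congr 1
    ext p
    simp only [Finset.mem_filter, Finset.mem_univ, true_and] at hi ⊢
    constructor
    · rintro rfl; exact ⟨hi, rfl⟩
    · exact fun h => h.2
  · intro p hp
    simpa using hp

theorem startPos_add_content (w : Fin n → Fin M) (l : Fin M) :
    startPos (content w) l + content w l = (Finset.univ.filter fun p => w p ≤ l).card := by
  rw [startPos_content, content, ← Finset.card_union_of_disjoint]
  · congr 1
    ext p
    simp [le_iff_lt_or_eq]
  · rw [Finset.disjoint_filter]
    intro p _ h h'
    exact absurd h' h.ne

theorem card_filter_comp_perm (σ : Equiv.Perm (Fin n)) (P : Fin n → Prop) [DecidablePred P] :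
    (Finset.univ.filter fun j => P (σ j)).card = (Finset.univ.filter P).card := by
  refine Finset.card_bij (fun j _ => σ j) ?_ (fun _ _ _ _ h => σ.injective h) ?_
  · intro j hj; simpa using hj
  · intro p hp
    exact ⟨σ.symm p, by simpa using hp, by simp⟩

theorem lt_startPos_iff (w : Fin n → Fin M) (l : Fin M) (j : Fin n) :
    (j : ℕ) < startPos (content w) l ↔ w (Tuple.sort w j) < l := by
  rw [startPos_content, ← card_filter_comp_perm (Tuple.sort w)]
  exact lt_card_filter_iff (Tuple.monotone_sort w) (P := (· < l)) (fun a b h h' => h.trans_lt h') j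

theorem lt_startPos_add_content_iff (w : Fin n → Fin M) (l : Fin M) (j : Fin n) :
    (j : ℕ) < startPos (content w) l + content w l ↔ w (Tuple.sort w j) ≤ l := by
  rw [startPos_add_content, ← card_filter_comp_perm (Tuple.sort w)]
  exact lt_card_filter_iff (Tuple.monotone_sort w) (P := (· ≤ l)) (fun a b h h' => h.trans h') j

theorem sort_lt_of_eq (w : Fin n → Fin M) {i j : Fin n} (hij : i < j)
    (h : w (Tuple.sort w i) = w (Tuple.sort w j)) : Tuple.sort w i < Tuple.sort w j :=
  (Tuple.eq_sort_iff.1 rfl).2 i j hij h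

theorem sort_add_le (w : Fin n → Fin M) (l : Fin M) (d : ℕ) (i j : Fin n) (hij : (j : ℕ) = i + d)
    (hi : w (Tuple.sort w i) = l) (hj : w (Tuple.sort w j) = l) :
    (Tuple.sort w i : ℕ) + d ≤ Tuple.sort w j := by
  induction d generalizing j with
  | zero =>
    have : i = j := Fin.ext (by omega)
    subst this
    simp
  | succ d ih =>
    have hlt : i.val + d < n := by omega
    have h1 : i ≤ ⟨i + d, hlt⟩ := by rw [Fin.le_def]; simp
    have h2 : (⟨i + d, hlt⟩ : Fin n) < j := by rw [Fin.lt_def, hij]; simp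
    have hmid : w (Tuple.sort w ⟨i + d, hlt⟩) = l :=
      le_antisymm (hj ▸ Tuple.monotone_sort w h2.le) (hi ▸ Tuple.monotone_sort w h1)
    have := ih ⟨i + d, hlt⟩ rfl hmid
    have h3 := sort_lt_of_eq w h2 (hmid.trans hj.symm)
    rw [Fin.lt_def] at h3
    omega

theorem valid_iff_allowed (s : Fin M → Ordering) (w : Fin n → Fin M) :
    (∀ j, s (w (Tuple.sort w j)) = cmp (Tuple.sort w j) j) ↔
      ∀ p : Fin n, allowed (s (w p)) (startPos (content w) (w p))
        (startPos (content w) (w p) + content w (w p)) p := by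
  set σ := Tuple.sort w with hσ
  have hblock : ∀ j, startPos (content w) (w (σ j)) ≤ j ∧
      (j : ℕ) < startPos (content w) (w (σ j)) + content w (w (σ j)) := fun j =>
    ⟨not_lt.1 fun h => lt_irrefl _ ((lt_startPos_iff w _ j).1 h),
      (lt_startPos_add_content_iff w _ j).2 le_rfl⟩
  have hin : ∀ j l, startPos (content w) l ≤ (j : Fin n) →
      (j : ℕ) < startPos (content w) l + content w l → w (σ j) = l := fun j l h h' =>
    le_antisymm ((lt_startPos_add_content_iff w _ j).1 h')
      (not_lt.1 fun h'' => absurd ((lt_startPos_iff w _ j).2 h'') (not_lt.2 h))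
  constructor
  · intro h p
    obtain ⟨j, rfl⟩ := σ.surjective p
    obtain ⟨h1, h2⟩ := hblock j
    rw [h j]
    rcases hc : cmp (σ j) j with _ | _ | _
    · have := (cmp_eq_lt_iff _ _).1 hc
      rw [Fin.lt_def] at this
      right; omega
    · have := (cmp_eq_eq_iff _ _).1 hc
      rw [Fin.ext_iff] at this
      exact ⟨by omega, by omega⟩
    · have := (cmp_eq_gt_iff _ _).1 hc
      rw [Fin.lt_def] at this
      right; omega
  · intro h j
    obtain ⟨h1, h2⟩ := hblock j
    set l := w (σ j) with hl
    set a := startPos (content w) l with ha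
    set b := startPos (content w) l + content w l with hb
    have hbn : b ≤ n := by
      rw [hb, startPos_add_content]
      simpa using Finset.card_filter_le (Finset.univ : Finset (Fin n)) (fun p => w p ≤ l)
    have hwa : w (σ ⟨a, by omega⟩) = l := hin _ _ le_rfl (by simp only; omega)
    have hwb : w (σ ⟨b - 1, by omega⟩) = l := hin _ _ (by simp only; omega) (by simp only; omega)
    have hla := sort_add_le w l (j - a) ⟨a, by omega⟩ j (by simp only; omega) hwa rfl
    have hlb := sort_add_le w l (b - 1 - j) j ⟨b - 1, by omega⟩ (by simp only; omega) rfl hwb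
    have haa := h (σ ⟨a, by omega⟩)
    have hbb := h (σ ⟨b - 1, by omega⟩)
    rw [hwa, ← ha, ← hb] at haa
    rw [hwb, ← ha, ← hb] at hbb
    rw [← hσ] at hla hlb
    symm
    rcases hs : s l with _ | _ | _
    · rw [hs] at hbb
      simp only [allowed] at hbb
      rw [cmp_eq_lt_iff, Fin.lt_def]
      omega
    · rw [hs] at hbb haa
      simp only [allowed] at hbb haa
      rw [cmp_eq_eq_iff, Fin.ext_iff]
      omega
    · rw [hs] at haa
      simp only [allowed] at haa
      rw [cmp_eq_gt_iff, Fin.lt_def]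
      omega

theorem prod_content {A : Type*} [CommMonoid A] (w : Fin n → Fin M) (y : Fin M → A) :
    ∏ l, y l ^ content w l = ∏ p, y (w p) := by
  rw [← Finset.prod_fiberwise' Finset.univ w y]
  simp [content]

theorem coeff_slotProd_zero {R : Type*} [CommRing R] (s : Fin M → Ordering) (c : Fin M → ℕ)
    (hc : ∑ l, c l = n) :
    MvPolynomial.coeff (Finsupp.equivFunOnFinite.symm c)
      (slotProd s c 0 (MvPolynomial.X (R := R))) =
    ∑ w : Fin n → Fin M, if (content w = c ∧ ∀ p : Fin n, allowed (s (w p)) (startPos c (w p))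
        (startPos c (w p) + c (w p)) p) then 1 else 0 := by
  rw [slotProd, hc, Finset.prod_range]
  simp only [slotForm, zero_add]
  rw [Fintype.prod_sum, MvPolynomial.coeff_sum]
  refine Finset.sum_congr rfl fun w _ => ?_
  rw [Finset.prod_ite_zero]
  have hX : ∏ p, MvPolynomial.X (R := R) (w p) =
      MvPolynomial.monomial (Finsupp.equivFunOnFinite.symm (content w)) 1 := by
    rw [← prod_content, MvPolynomial.monomial_eq, Finsupp.prod_fintype _ _ (by simp)]
    simp
  rw [hX]
  simp only [Finset.mem_univ, true_implies]
  by_cases h : ∀ p : Fin n, allowed (s (w p)) (startPos c (w p)) (startPos c (w p) + c (w p)) p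
  · rw [if_pos h, MvPolynomial.coeff_monomial]
    simp [h]
  · rw [if_neg h, if_neg (fun h' => h h'.2), MvPolynomial.coeff_zero]

theorem sum_valid_words {F : Type*} [Field F] (s : Fin M → Ordering) (y : Fin M → F) (n : ℕ) :
    (∑ w : Fin n → Fin M, if (∀ j, s (w (Tuple.sort w j)) = cmp (Tuple.sort w j) j) then
      ∏ p, y (w p) else 0) = PowerSeries.coeff n (slotSeries s y 0) := by
  rw [slotSeries, coeff_contentSeries]
  have h1 : ∀ c ∈ Finset.Nat.antidiagonalTuple M n, (∏ i, y i ^ c i) * (slotCount s c 0 : F) =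
      ∑ w : Fin n → Fin M, if content w = c then
        (if (∀ j, s (w (Tuple.sort w j)) = cmp (Tuple.sort w j) j) then
          ∏ p, y (w p) else 0) else 0 := by
    intro c hc
    have := coeff_ltSum_pow_mul_slotProd s c (0 : F) 0
    simp only [pow_zero, one_mul, mul_one, map_zero] at this
    rw [← this, coeff_slotProd_zero s c (Finset.Nat.mem_antidiagonalTuple.1 hc), Finset.mul_sum]
    refine Finset.sum_congr rfl fun w _ => ?_
    by_cases hw : content w = c
    · subst hw
      rw [prod_content]
      simp [valid_iff_allowed]
    · simp [hw]
  rw [Finset.sum_congr rfl h1, Finset.sum_comm]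
  refine Finset.sum_congr rfl fun w _ => ?_
  rw [Finset.sum_ite_eq, if_pos (Finset.Nat.mem_antidiagonalTuple.2 (sum_content w))]

end Words

section Encoding

/-- The numerical code of a letter type. -/
def typeCode : Ordering → ℕ
  | .lt => 0
  | .eq => 1
  | .gt => 2

/-- The type of a letter. -/
def letterType (i : ℕ) : Ordering :=
  if i % 3 = 0 then .lt else if i % 3 = 1 then .eq else .gt

theorem typeCode_lt (o : Ordering) : typeCode o < 3 := by
  cases o <;> simp [typeCode]

theorem letterType_code (a : ℕ) (o : Ordering) : letterType (3 * a + typeCode o) = o := by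
  cases o <;> simp [typeCode, letterType, Nat.add_mod]

theorem typeCode_letterType (i : ℕ) : 3 * (i / 3) + typeCode (letterType i) = i := by
  unfold letterType
  split_ifs <;> simp only [typeCode] <;> omega

theorem code_div (a : ℕ) (o : Ordering) : (3 * a + typeCode o) / 3 = a := by
  have := typeCode_lt o
  omega

/-- The indicator of a descent of `σ` at `i`. -/
def desInd {n : ℕ} (σ : Equiv.Perm (Fin n)) (i : ℕ) : ℕ := if pv σ (i + 1) < pv σ i then 1 else 0

theorem desInd_succ {n : ℕ} (σ : Equiv.Perm (Fin n)) (i : ℕ) (h : i + 1 < n) :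
    desInd σ (i + 1) = if σ ⟨i + 1, h⟩ < σ ⟨i, by omega⟩ then 1 else 0 := by
  rw [desInd, pv, pv, dif_pos (by omega), dif_pos (by omega)]
  simp only [Nat.add_sub_cancel, add_lt_add_iff_right, Fin.lt_def]

/-- Sequences that decrease weakly, and by at least `ε i` at the `i`-th step. -/
def IsDescChain {n N : ℕ} (ε : ℕ → ℕ) (b : Fin n → Fin N) : Prop :=
  ∀ i, (h : i + 1 < n) → (b ⟨i + 1, h⟩ : ℕ) + ε (i + 1) ≤ b ⟨i, by omega⟩

variable {n N : ℕ}

theorem IsDescChain.lex {σ : Equiv.Perm (Fin n)} {b : Fin n → Fin N} (hb : IsDescChain (desInd σ) b)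
    {i j : Fin n} (hij : i < j) : b j < b i ∨ b i = b j ∧ σ i < σ j := by
  obtain ⟨d, hd⟩ : ∃ d, (j : ℕ) = i + 1 + d := ⟨j - (i + 1), by rw [Fin.lt_def] at hij; omega⟩
  clear hij
  have hstep : ∀ k (h : k + 1 < n), b ⟨k + 1, h⟩ < b ⟨k, by omega⟩ ∨
      b ⟨k, by omega⟩ = b ⟨k + 1, h⟩ ∧ σ ⟨k, by omega⟩ < σ ⟨k + 1, h⟩ := by
    intro k h
    have := hb k h
    rw [desInd_succ σ k h] at this
    have hne : σ ⟨k, by omega⟩ ≠ σ ⟨k + 1, h⟩ := fun h' => by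
      have := σ.injective h'
      simp at this
    rw [Fin.lt_def, Fin.ext_iff]
    split_ifs at this with hlt
    · left; omega
    · have := lt_of_le_of_ne (not_lt.1 hlt) hne
      rcases Nat.lt_or_ge (b ⟨k + 1, h⟩) (b ⟨k, by omega⟩) with h' | h'
      · left; exact h'
      · right; exact ⟨by omega, this⟩
  induction d generalizing j with
  | zero =>
    have hj := hstep i (by omega)
    have : j = ⟨i + 1, by omega⟩ := Fin.ext (by simpa using hd)
    rw [this]; exact hj
  | succ d ih =>
    have hlt : (i : ℕ) + 1 + d < n := by omega
    have h1 := ih (j := ⟨i + 1 + d, hlt⟩) rfl hstep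
    have h2 := hstep (i + 1 + d) (by omega)
    have : j = ⟨i + 1 + d + 1, by omega⟩ := Fin.ext hd
    rw [this]
    rcases h1 with h1 | ⟨h1, h1'⟩ <;> rcases h2 with h2 | ⟨h2, h2'⟩
    · exact Or.inl (h2.trans h1)
    · exact Or.inl (h2 ▸ h1)
    · exact Or.inl (h1 ▸ h2)
    · exact Or.inr ⟨h1.trans h2, h1'.trans h2'⟩

theorem typeCode_cmp_le {n : ℕ} {a b c d : Fin n} (h : (a : ℕ) + d ≤ c + b) :
    typeCode (cmp a b) ≤ typeCode (cmp c d) := by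
  rcases lt_trichotomy a b with h1 | h1 | h1
  · rw [(cmp_eq_lt_iff _ _).2 h1]; simp [typeCode]
  · rcases lt_trichotomy c d with h2 | h2 | h2
    · rw [Fin.lt_def] at h2; rw [Fin.ext_iff] at h1; omega
    · rw [(cmp_eq_eq_iff _ _).2 h1, (cmp_eq_eq_iff _ _).2 h2]
    · rw [(cmp_eq_eq_iff _ _).2 h1, (cmp_eq_gt_iff _ _).2 h2]; simp [typeCode]
  · rcases lt_trichotomy c d with h2 | h2 | h2
    · rw [Fin.lt_def] at h2 h1; omega
    · rw [Fin.ext_iff] at h2; rw [Fin.lt_def] at h1; omega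
    · rw [(cmp_eq_gt_iff _ _).2 h1, (cmp_eq_gt_iff _ _).2 h2]

/-- The word of a permutation with a compatible sequence. -/
def encode (σ : Equiv.Perm (Fin n)) (b : Fin n → Fin (N + 1)) (p : Fin n) : Fin (3 * (N + 1)) :=
  ⟨3 * (N - b (σ.symm p)) + typeCode (cmp p (σ.symm p)), by
    have := typeCode_lt (cmp p (σ.symm p))
    omega⟩

/-- The compatible sequence of a word. -/
def decode (w : Fin n → Fin (3 * (N + 1))) (j : Fin n) : Fin (N + 1) :=
  ⟨N - (w (Tuple.sort w j) : ℕ) / 3, by omega⟩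

theorem encode_apply (σ : Equiv.Perm (Fin n)) (b : Fin n → Fin (N + 1)) (j : Fin n) :
    (encode σ b (σ j) : ℕ) = 3 * (N - b j) + typeCode (cmp (σ j) j) := by
  simp [encode]

theorem sort_encode {σ : Equiv.Perm (Fin n)} {b : Fin n → Fin (N + 1)}
    (hb : IsDescChain (desInd σ) b) : Tuple.sort (encode σ b) = σ := by
  symm
  rw [Tuple.eq_sort_iff]
  constructor
  · rcases n with _ | n
    · exact fun i => i.elim0
    rw [Fin.monotone_iff_le_succ]
    intro i
    rw [Fin.le_def]
    simp only [Function.comp_apply, encode_apply]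
    have h1 := typeCode_lt (cmp (σ i.castSucc) i.castSucc)
    have h2 := typeCode_lt (cmp (σ i.succ) i.succ)
    have h3 := (b i.castSucc).2
    rcases hb.lex (Fin.castSucc_lt_succ (i := i)) with h | ⟨h, h'⟩
    · rw [Fin.lt_def] at h
      omega
    · rw [Fin.lt_def] at h'
      have := typeCode_cmp_le (a := σ i.castSucc) (b := i.castSucc) (c := σ i.succ) (d := i.succ)
        (by simp only [Fin.val_succ, Fin.val_castSucc]; omega)
      rw [h]
      omega
  · intro i j hij h
    rw [Fin.ext_iff, encode_apply, encode_apply] at h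
    rcases hb.lex hij with h' | h'
    · rw [Fin.lt_def] at h'
      have h1 := typeCode_lt (cmp (σ i) i)
      have h2 := typeCode_lt (cmp (σ j) j)
      have h3 := (b i).2
      omega
    · exact h'.2

theorem decode_encode {σ : Equiv.Perm (Fin n)} {b : Fin n → Fin (N + 1)}
    (hb : IsDescChain (desInd σ) b) : decode (encode σ b) = b := by
  funext j
  apply Fin.ext
  have h : (decode (encode σ b) j : ℕ) =
    N - (encode σ b (Tuple.sort (encode σ b) j) : ℕ) / 3 := rfl
  rw [h, sort_encode hb, encode_apply, code_div]
  omega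

theorem valid_encode {σ : Equiv.Perm (Fin n)} {b : Fin n → Fin (N + 1)}
    (hb : IsDescChain (desInd σ) b) (j : Fin n) :
    letterType (encode σ b (Tuple.sort (encode σ b) j)) = cmp (Tuple.sort (encode σ b) j) j := by
  rw [sort_encode hb, encode_apply, letterType_code]

section Valid

variable {w : Fin n → Fin (3 * (N + 1))}
  (hw : ∀ j, letterType (w (Tuple.sort w j)) = cmp (Tuple.sort w j) j)
include hw

theorem word_sort_eq (j : Fin n) : (w (Tuple.sort w j) : ℕ) =
    3 * (w (Tuple.sort w j) / 3) + typeCode (cmp (Tuple.sort w j) j) := by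
  conv_lhs => rw [← typeCode_letterType (w (Tuple.sort w j)), hw]

theorem isChain_decode : IsDescChain (desInd (Tuple.sort w)) (decode w) := by
  intro i h
  rw [desInd_succ _ _ h]
  simp only [decode]
  have hle : (⟨i, by omega⟩ : Fin n) ≤ ⟨i + 1, h⟩ := by rw [Fin.le_def]; simp
  have hm := Tuple.monotone_sort w hle
  simp only [Function.comp_apply] at hm
  rw [Fin.le_def] at hm
  split_ifs with hd
  · have h1 := word_sort_eq hw ⟨i, by omega⟩
    have h2 := word_sort_eq hw ⟨i + 1, h⟩
    have h3 := (w (Tuple.sort w ⟨i + 1, h⟩)).2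
    have hne : w (Tuple.sort w ⟨i, by omega⟩) ≠ w (Tuple.sort w ⟨i + 1, h⟩) := fun h' =>
      lt_asymm hd (sort_lt_of_eq w (by rw [Fin.lt_def]; simp) h')
    rw [Ne, Fin.ext_iff] at hne
    have := typeCode_cmp_le (a := Tuple.sort w ⟨i + 1, h⟩) (b := ⟨i + 1, h⟩)
      (c := Tuple.sort w ⟨i, by omega⟩) (d := ⟨i, by omega⟩)
      (by rw [Fin.lt_def] at hd; simp only; omega)
    omega
  · omega

theorem encode_decode : encode (Tuple.sort w) (decode w) = w := by
  funext p
  obtain ⟨j, rfl⟩ := (Tuple.sort w).surjective p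
  apply Fin.ext
  rw [encode_apply]
  conv_rhs => rw [word_sort_eq hw]
  have := (w (Tuple.sort w j)).2
  simp only [decode]
  omega

end Valid

/-- The weight of a letter type. -/
def typeWeight {F : Type*} [One F] (r t : F) : Ordering → F
  | .lt => 1
  | .eq => r
  | .gt => t

open Classical in
theorem sum_perm_chain_eq_sum_words {F : Type*} [Field F] (q r t : F) (n N : ℕ) :
    ∑ σ : Equiv.Perm (Fin n), (∏ j, typeWeight r t (cmp (σ j) j)) *
      (∑ b : Fin n → Fin (N + 1), if IsDescChain (desInd σ) b then q ^ ∑ j, (b j : ℕ) else 0) =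
    ∑ w : Fin n → Fin (3 * (N + 1)),
      if (∀ j, letterType (w (Tuple.sort w j)) = cmp (Tuple.sort w j) j) then
        ∏ p, (q ^ (N - (w p : ℕ) / 3) * typeWeight r t (letterType (w p))) else 0 := by
  simp only [Finset.mul_sum]
  rw [← Finset.sum_product']
  simp only [mul_ite, mul_zero]
  rw [← Finset.sum_filter, ← Finset.sum_filter]
  refine Finset.sum_bij' (fun x _ => encode x.1 x.2) (fun w _ => (Tuple.sort w, decode w))
    ?_ ?_ ?_ ?_ ?_
  · rintro ⟨σ, b⟩ hx
    simp only [Finset.mem_filter, Finset.mem_product, Finset.mem_univ, true_and, and_self] at hx ⊢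
    exact valid_encode hx
  · intro w hw
    simp only [Finset.mem_filter, Finset.mem_product, Finset.mem_univ, true_and, and_self] at hw ⊢
    exact isChain_decode hw
  · rintro ⟨σ, b⟩ hx
    simp only [Finset.mem_filter, Finset.mem_product, Finset.mem_univ, true_and, and_self] at hx
    simp only [sort_encode hx, decode_encode hx]
  · intro w hw
    simp only [Finset.mem_filter, Finset.mem_univ, true_and] at hw
    exact encode_decode hw
  · rintro ⟨σ, b⟩ hx
    simp only
    rw [← Equiv.prod_comp σ (fun p => q ^ (N - (encode σ b p : ℕ) / 3) *
      typeWeight r t (letterType (encode σ b p))), ← Finset.prod_pow_eq_pow_sum,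
      ← Finset.prod_mul_distrib]
    refine Finset.prod_congr rfl fun j _ => ?_
    rw [encode_apply, code_div, letterType_code, mul_comm]
    congr 2
    omega

end Encoding

section Limits

variable {F : Type*} [Field F]

/-- `f N` is a polynomial in `q ^ N` of degree at most `d` with constant term `a`. -/
def HasLim (q : F) (d : ℕ) (f : ℕ → F) (a : F) : Prop :=
  ∃ p : Polynomial F, p.natDegree ≤ d ∧ (∀ N, p.eval (q ^ N) = f N) ∧ p.coeff 0 = a

variable {q : F}

theorem HasLim.const (c : F) : HasLim q 0 (fun _ => c) c :=
  ⟨Polynomial.C c, by simp, by simp, by simp⟩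

theorem HasLim.mono {d d' : ℕ} (hd : d ≤ d') {f : ℕ → F} {a : F} (h : HasLim q d f a) :
    HasLim q d' f a := by
  obtain ⟨p, h1, h2, h3⟩ := h
  exact ⟨p, h1.trans hd, h2, h3⟩

theorem HasLim.mul {d d' : ℕ} {f g : ℕ → F} {a b : F} (hf : HasLim q d f a)
    (hg : HasLim q d' g b) : HasLim q (d + d') (fun N => f N * g N) (a * b) := by
  obtain ⟨p, h1, h2, h3⟩ := hf
  obtain ⟨p', h1', h2', h3'⟩ := hg
  exact ⟨p * p', Polynomial.natDegree_mul_le_of_le h1 h1', by simp [h2, h2'],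
    by rw [Polynomial.mul_coeff_zero, h3, h3']⟩

theorem HasLim.const_mul {d : ℕ} {f : ℕ → F} {a : F} (c : F) (hf : HasLim q d f a) :
    HasLim q d (fun N => c * f N) (c * a) := by
  simpa using (HasLim.const c).mul hf

theorem HasLim.sum {ι : Type*} {d : ℕ} (s : Finset ι) {f : ι → ℕ → F} {a : ι → F}
    (h : ∀ i ∈ s, HasLim q d (f i) (a i)) :
    HasLim q d (fun N => ∑ i ∈ s, f i N) (∑ i ∈ s, a i) := by
  choose! p h1 h2 h3 using h
  refine ⟨∑ i ∈ s, p i, Polynomial.natDegree_sum_le_of_forall_le _ _ h1, fun N => ?_, ?_⟩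
  · rw [Polynomial.eval_finsetSum]
    exact Finset.sum_congr rfl fun i hi => h2 i hi N
  · rw [Polynomial.finsetSum_coeff]
    exact Finset.sum_congr rfl fun i hi => h3 i hi

theorem HasLim.shift {d : ℕ} {f : ℕ → F} {a : F} (h : HasLim q d f a) :
    HasLim q d (fun N => f (N + 1)) a := by
  obtain ⟨p, h1, h2, h3⟩ := h
  refine ⟨p.comp (Polynomial.C q * Polynomial.X), ?_, fun N => ?_, ?_⟩
  · refine Polynomial.natDegree_comp_le.trans ?_
    calc p.natDegree * (Polynomial.C q * Polynomial.X).natDegree ≤ d * 1 :=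
          Nat.mul_le_mul h1 ((Polynomial.natDegree_C_mul_le _ _).trans Polynomial.natDegree_X_le)
      _ = d := mul_one d
  · simp only [← h2, Polynomial.eval_comp, pow_succ', Polynomial.eval_mul, Polynomial.eval_C,
      Polynomial.eval_X]
  · rw [Polynomial.coeff_zero_eq_eval_zero, Polynomial.eval_comp, ← h3,
      Polynomial.coeff_zero_eq_eval_zero]
    simp

variable (hq0 : q ≠ 0) (hq : ∀ k, q ^ (k + 1) ≠ 1)
include hq0 hq

theorem pow_ne_pow {i j : ℕ} (h : i < j) : q ^ i ≠ q ^ j := by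
  obtain ⟨k, rfl⟩ := Nat.exists_eq_add_of_lt h
  intro h'
  rw [add_assoc, pow_add] at h'
  exact hq k (mul_left_cancel₀ (pow_ne_zero i hq0) (by rw [mul_one]; exact h'.symm))

theorem HasLim.unique {d d' : ℕ} {f : ℕ → F} {a b : F} (hf : HasLim q d f a)
    (hg : HasLim q d' f b) : a = b := by
  obtain ⟨p, -, h2, h3⟩ := hf
  obtain ⟨p', -, h2', h3'⟩ := hg
  have hinj : Function.Injective fun N : ℕ => q ^ N := by
    intro i j hij
    rcases lt_trichotomy i j with h | h | h
    · exact absurd hij (pow_ne_pow hq0 hq h)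
    · exact h
    · exact absurd hij.symm (pow_ne_pow hq0 hq h)
  have : p = p' := Polynomial.eq_of_infinite_eval_eq p p'
    ((Set.infinite_range_of_injective hinj).mono (by rintro _ ⟨N, rfl⟩; simp [h2, h2']))
  rw [← h3, ← h3', this]

theorem HasLim.of_recursion {n : ℕ} {f g : ℕ → F} {a : F} (hg : HasLim q n g a)
    (hf : ∀ N, f (N + 1) = q ^ (n + 1) * f N + g N) :
    HasLim q (n + 1) f (a / (1 - q ^ (n + 1))) := by
  obtain ⟨p, h1, h2, h3⟩ := hg
  have hpne : ∀ k ∈ Finset.range (n + 1), q ^ k - q ^ (n + 1) ≠ 0 := fun k hk =>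
    sub_ne_zero.2 (pow_ne_pow hq0 hq (Finset.mem_range.1 hk))
  let P : Polynomial F := ∑ k ∈ Finset.range (n + 1),
    Polynomial.C (p.coeff k / (q ^ k - q ^ (n + 1))) * Polynomial.X ^ k
  let R : Polynomial F := P + Polynomial.C (f 0 - P.eval 1) * Polynomial.X ^ (n + 1)
  have hP : P.natDegree ≤ n + 1 := Polynomial.natDegree_sum_le_of_forall_le _ _ fun k hk =>
    (Polynomial.natDegree_C_mul_X_pow_le _ _).trans (Finset.mem_range.1 hk).le
  refine ⟨R, Polynomial.natDegree_add_le_of_degree_le hP (Polynomial.natDegree_C_mul_X_pow_le _ _),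
    fun N => ?_, ?_⟩
  · induction N with
    | zero => simp [R]
    | succ N ih =>
      rw [hf, ← ih, ← h2, Polynomial.eval_eq_sum_range' (Nat.lt_succ_of_le h1)]
      have hPs : P.eval (q ^ (N + 1)) = q ^ (n + 1) * P.eval (q ^ N) +
          ∑ i ∈ Finset.range (n + 1), p.coeff i * (q ^ N) ^ i := by
        simp only [P, Polynomial.eval_finsetSum, Polynomial.eval_mul, Polynomial.eval_C,
          Polynomial.eval_pow, Polynomial.eval_X]
        rw [Finset.mul_sum, ← Finset.sum_add_distrib]
        refine Finset.sum_congr rfl fun k hk => ?_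
        have := hpne k hk
        rw [pow_succ q N, mul_pow]
        field_simp
        ring
      simp only [R, Polynomial.eval_add, hPs, Polynomial.eval_mul, Polynomial.eval_C,
          Polynomial.eval_pow, Polynomial.eval_X]
      ring
  · have := hpne 0 (by simp)
    simp only [R, P, Polynomial.coeff_add, Polynomial.finsetSum_coeff, Polynomial.coeff_C_mul_X_pow]
    rw [Finset.sum_eq_single_of_mem 0 (by simp)]
    · simp [h3]
    · intro k _ hk
      rw [if_neg (Ne.symm hk)]

omit hq0 hq

/-- The `q`-Pochhammer symbol `(q; q)ₙ`. -/
def qPoch (q : F) (n : ℕ) : F := ∏ i ∈ Finset.range n, (1 - q ^ (i + 1))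

theorem qPoch_succ (q : F) (n : ℕ) : qPoch q (n + 1) = qPoch q n * (1 - q ^ (n + 1)) :=
  Finset.prod_range_succ _ _

/-- The sum of `q ^ (b₁ + ⋯ + bₙ)` over the sequences `hi ≥ b₁ ≥ ⋯ ≥ bₙ ≥ lo` with gaps
bounded below by `ε`. -/
def chainSum (q : F) (ε : ℕ → ℕ) : ℕ → ℕ → ℕ → F
  | 0, _, _ => 1
  | n + 1, lo, hi => ∑ x ∈ Finset.Ico lo (hi + 1), q ^ x * chainSum q ε n (x + ε n) hi

theorem chainSum_shift (q : F) (ε : ℕ → ℕ) (n lo hi : ℕ) :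
    chainSum q ε n (lo + 1) (hi + 1) = q ^ n * chainSum q ε n lo hi := by
  induction n generalizing lo with
  | zero => simp [chainSum]
  | succ n ih =>
    rw [chainSum, chainSum, ← Finset.sum_Ico_add', Finset.mul_sum]
    refine Finset.sum_congr rfl fun x _ => ?_
    rw [show x + 1 + ε n = x + ε n + 1 by ring, ih]
    ring

theorem chainSum_succ (q : F) (ε : ℕ → ℕ) (n N : ℕ) :
    chainSum q ε (n + 1) 0 (N + 1) =
      q ^ (n + 1) * chainSum q ε (n + 1) 0 N + chainSum q ε n (ε n) (N + 1) := by
  rw [← chainSum_shift]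
  conv_lhs => rw [chainSum, Finset.sum_eq_sum_Ico_succ_bot (by omega)]
  conv_rhs => rw [chainSum]
  simp only [zero_add, pow_zero, one_mul]
  rw [add_comm]

include hq0 hq in
theorem hasLim_chainSum (ε : ℕ → ℕ) (hε : ∀ i, ε i = 0 ∨ ε i = 1) (n : ℕ) :
    HasLim q n (fun N => chainSum q ε n 0 N)
      (q ^ (∑ i ∈ Finset.range n, i * ε i) / qPoch q n) := by
  induction n with
  | zero => simpa [chainSum, qPoch] using HasLim.const (q := q) (1 : F)
  | succ n ih =>
    have h1 : HasLim q n (fun N => chainSum q ε n (ε n) (N + 1))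
        (q ^ (n * ε n) * (q ^ (∑ i ∈ Finset.range n, i * ε i) / qPoch q n)) := by
      rcases hε n with h | h
      · simpa [h] using ih.shift
      · have := ih.const_mul (q ^ n)
        simp only [← chainSum_shift] at this
        simpa [h] using this
    have := HasLim.of_recursion hq0 hq h1 (chainSum_succ q ε n)
    convert this using 1
    rw [qPoch_succ, Finset.sum_range_succ, pow_add, ← mul_div_assoc, div_div, mul_comm (q ^ (n * ε n))]

/-- The complete homogeneous symmetric polynomial of degree `k` in `1, q, …, q ^ (N - 1)`. -/
def hSum (q : F) : ℕ → ℕ → F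
  | 0, _ => 1
  | _ + 1, 0 => 0
  | k + 1, N + 1 => q ^ (k + 1) * hSum q (k + 1) N + hSum q k (N + 1)

include hq0 hq in
theorem hasLim_hSum (k : ℕ) : HasLim q k (hSum q k) (1 / qPoch q k) := by
  induction k with
  | zero =>
    have : hSum q 0 = fun _ => 1 := by funext N; rw [hSum]
    rw [this]
    simpa [qPoch] using HasLim.const (q := q) (1 : F)
  | succ k ih =>
    have := HasLim.of_recursion (f := hSum q (k + 1)) (g := fun N => hSum q k (N + 1)) hq0 hq
      ih.shift (fun N => by simp only [hSum])
    rwa [div_div, ← qPoch_succ] at this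

open Classical in
theorem sum_isDescChain (q : F) (ε : ℕ → ℕ) (n lo N : ℕ) :
    (∑ b : Fin n → Fin (N + 1), if IsDescChain ε b ∧ ∀ i, lo ≤ (b i : ℕ) then
      q ^ ∑ j, (b j : ℕ) else 0) = chainSum q ε n lo N := by
  induction n generalizing lo with
  | zero => simp [chainSum, IsDescChain]
  | succ n ih =>
    rw [chainSum, ← (Fin.snocEquiv fun _ : Fin (n + 1) => Fin (N + 1)).sum_comp,
      Fintype.sum_prod_type]
    have hx : ∀ x : Fin (N + 1), (∑ b : Fin n → Fin (N + 1),
        if IsDescChain ε (Fin.snoc (α := fun _ => Fin (N + 1)) b x) ∧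
          ∀ i, lo ≤ (Fin.snoc (α := fun _ => Fin (N + 1)) b x i : ℕ) then
        q ^ ∑ j, (Fin.snoc (α := fun _ => Fin (N + 1)) b x j : ℕ) else 0) =
        if lo ≤ (x : ℕ) then q ^ (x : ℕ) * chainSum q ε n (x + ε n) N else 0 := by
      intro x
      have hiff : ∀ b : Fin n → Fin (N + 1),
          (IsDescChain ε (Fin.snoc (α := fun _ => Fin (N + 1)) b x) ∧
            ∀ i, lo ≤ (Fin.snoc (α := fun _ => Fin (N + 1)) b x i : ℕ)) ↔
          lo ≤ (x : ℕ) ∧ IsDescChain ε b ∧ ∀ i, (x : ℕ) + ε n ≤ b i := by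
        intro b
        have hsn : ∀ i (h : i < n), Fin.snoc (α := fun _ => Fin (N + 1)) b x ⟨i, by omega⟩ =
            b ⟨i, h⟩ := fun i h => Fin.snoc_castSucc (α := fun _ => Fin (N + 1)) x b ⟨i, h⟩
        have hsl : Fin.snoc (α := fun _ => Fin (N + 1)) b x ⟨n, by omega⟩ = x :=
          Fin.snoc_last (α := fun _ => Fin (N + 1)) x b
        constructor
        · rintro ⟨hc, hl⟩
          have hb : IsDescChain ε b := by
            intro i h
            have := hc i (by omega)
            rwa [hsn _ h, hsn i (by omega)] at this
          refine ⟨by simpa [hsl] using hl ⟨n, by omega⟩, hb, ?_⟩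
          have hd : ∀ d i (h : i + d + 1 = n), (x : ℕ) + ε n ≤ b ⟨i, by omega⟩ := by
            intro d
            induction d with
            | zero =>
              intro i h
              have := hc i (by omega)
              obtain rfl : i + 1 = n := h
              rwa [hsl, hsn i (by omega)] at this
            | succ d ihd =>
              intro i h
              have h1 := ihd (i + 1) (by omega)
              have h2 := hb i (by omega)
              omega
          exact fun i => hd (n - 1 - i) i (by omega)
        · rintro ⟨hl, hb, hxb⟩
          refine ⟨fun i h => ?_, fun i => ?_⟩
          · rcases Nat.lt_or_ge (i + 1) n with h' | h'
            · rw [hsn _ h', hsn i (by omega)]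
              exact hb i h'
            · obtain rfl : i + 1 = n := by omega
              rw [hsl, hsn i (by omega)]
              exact hxb _
          · refine Fin.lastCases ?_ (fun i => ?_) i
            · rw [Fin.snoc_last]; exact hl
            · rw [Fin.snoc_castSucc]
              have := hxb i
              omega
      rw [← ih, Finset.mul_sum]
      simp only [hiff, Fin.sum_univ_castSucc, Fin.snoc_castSucc, Fin.snoc_last]
      split_ifs with hlo
      · refine Finset.sum_congr rfl fun b _ => ?_
        simp only [hlo, true_and, mul_ite, mul_zero]
        rw [pow_add, mul_comm]
      · simp [hlo]
    refine (Finset.sum_congr rfl fun x _ => hx x).trans ?_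
    rw [Fin.sum_univ_eq_sum_range (fun x => if lo ≤ x then q ^ x * chainSum q ε n (x + ε n) N else 0),
      ← Finset.sum_filter]
    refine Finset.sum_congr ?_ fun _ _ => rfl
    ext x
    simp only [Finset.mem_filter, Finset.mem_range, Finset.mem_Ico]
    omega

end Limits

section Evaluation

open PowerSeries

variable {F : Type*} [Field F]

/-- The generating function of `hSum`, with argument scaled by `y`. -/
def hSeries (q y : F) (N : ℕ) : F⟦X⟧ := PowerSeries.mk fun k => y ^ k * hSum q k N

theorem hSeries_succ (q y : F) (N : ℕ) :
    hSeries q y (N + 1) * (1 - C y * X) = hSeries q (y * q) N := by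
  ext k
  rw [mul_sub, mul_one, map_sub, mul_comm (C y), ← mul_assoc]
  cases k with
  | zero => simp [hSeries, hSum]
  | succ k =>
    rw [coeff_mul_C, coeff_succ_mul_X]
    simp only [hSeries, coeff_mk, hSum]
    ring

theorem hSeries_mul_prod (q y : F) (N : ℕ) :
    hSeries q y N * ∏ i ∈ Finset.range N, (1 - C y * (X * C (q ^ i))) = 1 := by
  induction N generalizing y with
  | zero =>
    ext k
    rcases k with _ | k <;> simp [hSeries, hSum, coeff_one]
  | succ N ih =>
    have h := ih (y * q)
    rw [← hSeries_succ] at h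
    refine Eq.trans ?_ h
    rw [Finset.prod_range_succ']
    simp only [pow_zero, map_one, mul_one, map_mul, pow_succ']
    rw [mul_assoc, mul_comm (∏ i ∈ Finset.range N, _)]
    simp only [mul_left_comm X, mul_assoc]

/-- The denominators in the evaluation of the generating function of words. -/
def wordDenom (q t : F) : ℕ → F⟦X⟧
  | 0 => 1
  | m + 1 => (1 - X * C (q ^ m)) * (wordDenom q t m -
      C t * (X * C (q ^ m)) * ∏ i ∈ Finset.range m, (1 - C t * (X * C (q ^ i))))

/-- The weights of the letters. -/
def letterWeight (q r t : F) (m : ℕ) (i : Fin (3 * m)) : F :=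
  q ^ (m - 1 - (i : ℕ) / 3) * typeWeight r t (letterType i)

theorem inv_mul_one_sub_X_mul (f : F⟦X⟧) : (1 - X * f)⁻¹ * (1 - X * f) = 1 :=
  PowerSeries.inv_mul_cancel _ (by simp)

theorem slotSeries_letterWeight (q r t : F) (m : ℕ) :
    ∃ g v : F⟦X⟧, (∀ h, slotSeries (fun i : Fin (3 * m) => letterType i) (letterWeight q r t m) h =
        g * v ^ h) ∧
      v * wordDenom q t m = (∏ i ∈ Finset.range m, (1 - C t * (X * C (q ^ i)))) - wordDenom q t m ∧
      g * wordDenom q t m * ∏ i ∈ Finset.range m, (1 - C r * (X * C (q ^ i))) =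
        (∏ i ∈ Finset.range m, (1 - C t * (X * C (q ^ i)))) *
          ∏ i ∈ Finset.range m, (1 - X * C (q ^ i)) := by
  induction m with
  | zero =>
    exact ⟨1, 0, fun h => slotSeries_zero _ _ h, by simp [wordDenom], by simp [wordDenom]⟩
  | succ m ih =>
    obtain ⟨g, v, hgv, hv, hg⟩ := ih
    let y : Fin (3 * m + 3) → F := letterWeight q r t (m + 1)
    let s : Fin (3 * m + 3) → Ordering := fun i => letterType i
    have hmod (i : ℕ) : letterType (i + 1 + 1 + 1) = letterType i := by
      have : (i + 1 + 1 + 1) % 3 = i % 3 := by omega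
      simp only [letterType, this]
    have hs3 : Fin.tail (Fin.tail (Fin.tail s)) = fun i : Fin (3 * m) => letterType i := by
      funext i
      simp only [Fin.tail, s, Fin.val_succ, hmod]
    have hy3 : Fin.tail (Fin.tail (Fin.tail y)) = letterWeight q r t m := by
      funext i
      have h2 : m + 1 - 1 - ((i : ℕ) + 1 + 1 + 1) / 3 = m - 1 - (i : ℕ) / 3 := by omega
      simp only [Fin.tail, y, letterWeight, Fin.val_succ, hmod, h2]
    have hy0 : y 0 = q ^ m := by simp [y, letterWeight, letterType, typeWeight]
    have hy1 : Fin.tail y 0 = q ^ m * r := by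
      simp only [Fin.tail, y, letterWeight, Fin.val_succ, Fin.val_zero]
      norm_num [letterType, typeWeight]
    have hy2 : Fin.tail (Fin.tail y) 0 = q ^ m * t := by
      simp only [Fin.tail, y, letterWeight, Fin.val_succ, Fin.val_zero]
      norm_num [letterType, typeWeight]
    rw [← hs3, ← hy3] at hgv
    have hu1 := inv_mul_one_sub_X_mul (C (Fin.tail (Fin.tail y) 0) * (1 + v))
    rw [← mul_assoc X] at hu1
    have hu2 := inv_mul_one_sub_X_mul (C (Fin.tail y 0))
    have hu3 := inv_mul_one_sub_X_mul (C (y 0))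
    have h1 := slotSeries_gt hgv (by simp [Fin.tail, s, letterType]) hu1
    have h2 := slotSeries_eq h1 (by simp [Fin.tail, s, letterType]) hu2
    have h3 := slotSeries_lt h2 (by simp [s, letterType]) hu3
    have hprod (z : F) : ∏ i ∈ Finset.range (m + 1), (1 - C z * (X * C (q ^ i))) =
        (∏ i ∈ Finset.range m, (1 - C z * (X * C (q ^ i)))) * (1 - C z * (X * C (q ^ m))) :=
      Finset.prod_range_succ _ _
    refine ⟨_, _, h3, ?_, ?_⟩ <;>
    · clear h1 h2 h3 hgv hs3 hy3 hmod
      rw [hprod, wordDenom]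
      try rw [hprod, Finset.prod_range_succ (fun i => 1 - X * C (q ^ i))]
      clear hprod
      revert hu1 hu2 hu3
      rw [hy0, hy1, hy2, map_mul, map_mul, mul_comm (C (q ^ m)) (C r), mul_comm (C (q ^ m)) (C t),
        mul_left_comm X (C r), mul_left_comm X (C t)]
      generalize (1 - C t * (X * C (q ^ m)) * (1 + v))⁻¹ = u1
      generalize (1 - C r * (X * C (q ^ m)))⁻¹ = u2
      generalize (1 - X * C (q ^ m))⁻¹ = u3
      intro hu1 hu2 hu3
      generalize (∏ i ∈ Finset.range m, (1 - C t * (X * C (q ^ i)))) = e at *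
      generalize (∏ i ∈ Finset.range m, (1 - C r * (X * C (q ^ i)))) = p at *
      generalize (∏ i ∈ Finset.range m, (1 - X * C (q ^ i))) = f at *
      generalize wordDenom q t m = d at *
      generalize X * C (q ^ m) = x at *
      have h : u1 * (d - C t * x * e) = d := by
        linear_combination d * hu1 + C t * x * u1 * hv
      first
        | linear_combination (v * u1 + x) * (d - C t * x * e) * hu3 + v * h + hv
        | linear_combination
            g * (1 - C t * x) * (1 - x) * p * u1 * (d - C t * x * e) * hu2 +
            g * (1 - C t * x) * (1 - x) * p * h + (1 - C t * x) * (1 - x) * hg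

theorem wordDenom_succ_closed (q t : F) (N : ℕ) :
    (1 - C (t * q)) * wordDenom q t (N + 1) = (1 - X * C (q ^ N)) *
      ((1 - C t * X) * ∏ i ∈ Finset.range N, (1 - X * C (q ^ i)) -
        C (t * q) * ∏ i ∈ Finset.range (N + 1), (1 - C t * (X * C (q ^ i)))) := by
  induction N with
  | zero =>
    simp [wordDenom]
    ring
  | succ N ih =>
    rw [wordDenom, mul_left_comm, mul_sub, ih, Finset.prod_range_succ (fun i => 1 - X * C (q ^ i)),
      Finset.prod_range_succ (fun i => 1 - C t * (X * C (q ^ i))) (N + 1)]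
    generalize (∏ i ∈ Finset.range (N + 1), (1 - C t * (X * C (q ^ i)))) = e
    simp only [pow_succ, map_mul]
    ring

theorem slotSeries_letterWeight_mul (q r t : F) (N : ℕ) :
    slotSeries (fun i : Fin (3 * (N + 1)) => letterType i) (letterWeight q r t (N + 1)) 0 *
        (hSeries q (t * q) N - C (t * q) * hSeries q 1 N) =
      (1 - C (t * q)) * hSeries q r (N + 1) := by
  obtain ⟨g, v, hgv, -, hg⟩ := slotSeries_letterWeight q r t (N + 1)
  rw [hgv, pow_zero, mul_one]
  have hd := wordDenom_succ_closed q t N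
  have ht := hSeries_mul_prod q (t * q) N
  have h1 := hSeries_mul_prod q 1 N
  have hr := hSeries_mul_prod q r (N + 1)
  have he : ∏ i ∈ Finset.range (N + 1), (1 - C t * (X * C (q ^ i))) =
      (∏ i ∈ Finset.range N, (1 - C (t * q) * (X * C (q ^ i)))) * (1 - C t * X) := by
    rw [Finset.prod_range_succ']
    simp only [pow_zero, map_one, mul_one, map_mul, pow_succ']
    simp only [mul_left_comm X, mul_assoc]
  rw [he] at hd hg
  rw [Finset.prod_range_succ (fun i => 1 - X * C (q ^ i))] at hg
  simp only [map_one, one_mul] at h1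
  have hne (z : F) : (1 - X * C z : F⟦X⟧) ≠ 0 := fun h => by
    simpa using congrArg (constantCoeff (R := F)) h
  refine mul_left_cancel₀ (mul_ne_zero (hne (q ^ N)) (hne t)) ?_
  rw [mul_comm X (C t)]
  generalize (∏ i ∈ Finset.range N, (1 - C (t * q) * (X * C (q ^ i)))) = e at *
  generalize (∏ i ∈ Finset.range (N + 1), (1 - C r * (X * C (q ^ i)))) = p at *
  generalize (∏ i ∈ Finset.range N, (1 - X * C (q ^ i))) = f at *
  generalize wordDenom q t (N + 1) = d at *
  generalize hSeries q (t * q) N = Et at *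
  generalize hSeries q 1 N = E1 at *
  generalize hSeries q r (N + 1) = Er at *
  generalize X * C (q ^ N) = x at *
  generalize 1 - C t * X = z at *
  generalize C (t * q) = c at *
  have hd' : (1 - c) * d * Et * E1 = (1 - x) * z * (Et - c * E1) := by
    linear_combination Et * E1 * hd + (1 - x) * z * Et * h1 - (1 - x) * z * c * E1 * ht
  linear_combination (-g) * hd' - g * (1 - c) * d * Et * E1 * hr +
    (1 - c) * Er * Et * E1 * hg + (1 - c) * Er * z * (1 - x) * Et * e * h1 +
    (1 - c) * Er * z * (1 - x) * ht

/-- Weighted count of permutations, truncated at level `N`. -/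
def truncCount (q r t : F) (n N : ℕ) : F :=
  ∑ σ : Equiv.Perm (Fin n), (∏ j, typeWeight r t (cmp (σ j) j)) *
    chainSum q (desInd σ) n 0 N

theorem truncCount_eq (q r t : F) (n N : ℕ) :
    truncCount q r t n N = coeff n (slotSeries (fun i : Fin (3 * (N + 1)) => letterType i)
      (letterWeight q r t (N + 1)) 0) := by
  rw [← sum_valid_words]
  have h := sum_perm_chain_eq_sum_words q r t n N
  rw [truncCount]
  simp only [← sum_isDescChain, Nat.zero_le, implies_true, and_true]
  simp only [letterWeight, Nat.add_sub_cancel]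
  convert h using 7
  exact and_iff_left fun _ => Nat.zero_le _

theorem sum_truncCount (q r t : F) (n N : ℕ) :
    ∑ p ∈ Finset.HasAntidiagonal.antidiagonal n, truncCount q r t p.1 N *
        (((t * q) ^ p.2 - t * q) * hSum q p.2 N) =
      (1 - t * q) * r ^ n * hSum q n (N + 1) := by
  have h := congrArg (coeff n) (slotSeries_letterWeight_mul q r t N)
  rw [coeff_mul] at h
  have hc : (1 - C (t * q) : F⟦X⟧) = C (1 - t * q) := by simp
  rw [hc, coeff_C_mul] at h
  simp only [map_sub, coeff_C_mul, hSeries, coeff_mk, one_pow, one_mul, ← truncCount_eq] at h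
  rw [mul_assoc, ← h]
  refine Finset.sum_congr rfl fun p _ => ?_
  ring

theorem sum_range_mul_desInd {n : ℕ} (σ : Equiv.Perm (Fin n)) :
    ∑ i ∈ Finset.range n, i * desInd σ i = maj σ := by
  rw [maj, DesSet, Finset.sum_filter]
  simp only [desInd, mul_ite, mul_one, mul_zero]
  refine (Finset.sum_subset (fun i hi => ?_) fun i hi hi' => ?_).symm
  · simp only [Finset.mem_Icc, Finset.mem_range] at *
    omega
  · simp only [Finset.mem_Icc, Finset.mem_range] at *
    obtain rfl : i = 0 := by omega
    simp

/-- The generating polynomial of permutations by major index, weighted by `typeWeight`. -/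
def majCount (q r t : F) (n : ℕ) : F :=
  ∑ σ : Equiv.Perm (Fin n), (∏ j, typeWeight r t (cmp (σ j) j)) * q ^ maj σ

theorem hasLim_truncCount {q : F} (hq0 : q ≠ 0) (hq : ∀ k, q ^ (k + 1) ≠ 1) (r t : F) (n : ℕ) :
    HasLim q n (truncCount q r t n) (majCount q r t n / qPoch q n) := by
  have h := HasLim.sum (q := q) (d := n) (Finset.univ : Finset (Equiv.Perm (Fin n)))
    fun σ _ => (hasLim_chainSum hq0 hq (desInd σ)
      (fun i => by unfold desInd; split_ifs <;> simp) n).const_mul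
        (∏ j, typeWeight r t (cmp (σ j) j))
  simp only [sum_range_mul_desInd] at h
  convert h using 1
  · rfl
  · rw [majCount, Finset.sum_div]
    simp only [mul_div_assoc]

theorem sum_majCount {q : F} (hq0 : q ≠ 0) (hq : ∀ k, q ^ (k + 1) ≠ 1) (r t : F) (n : ℕ) :
    ∑ p ∈ Finset.HasAntidiagonal.antidiagonal n, majCount q r t p.1 / qPoch q p.1 *
        (((t * q) ^ p.2 - t * q) * (1 / qPoch q p.2)) =
      (1 - t * q) * r ^ n * (1 / qPoch q n) := by
  have h := (hasLim_hSum hq0 hq n).shift.const_mul ((1 - t * q) * r ^ n)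
  simp only [← sum_truncCount q r t n] at h
  refine HasLim.unique hq0 hq (d := n) (HasLim.sum _ fun p hp => ?_) h
  rw [← Finset.HasAntidiagonal.mem_antidiagonal.1 hp]
  exact (hasLim_truncCount hq0 hq r t p.1).mul ((hasLim_hSum hq0 hq p.2).const_mul _)

end Evaluation

theorem prod_typeWeight {F : Type*} [Field F] (r t : F) {n : ℕ} (σ : Equiv.Perm (Fin n)) :
    ∏ j, typeWeight r t (cmp (σ j) j) = t ^ exc σ * r ^ fixStat σ := by
  have hpv (j : Fin n) : pv σ (j + 1) = σ j + 1 := by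
    have hj : 1 ≤ (j : ℕ) + 1 ∧ (j : ℕ) + 1 ≤ n := ⟨by omega, j.2⟩
    rw [pv, dif_pos hj]
    simp only [Nat.add_sub_cancel]
  have hinj (s : Finset (Fin n)) : Set.InjOn (fun j : Fin n => (j : ℕ) + 1) s := by
    intro i _ j _ h
    exact Fin.ext (Nat.succ_injective h)
  have hexc : exc σ = (Finset.univ.filter fun j => j < σ j).card := by
    rw [exc, ← Finset.card_image_of_injOn (hinj _)]
    congr 1
    ext i
    simp only [ExcSet, Finset.mem_filter, Finset.mem_Icc, Finset.mem_image, Finset.mem_univ,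
      true_and]
    constructor
    · rintro ⟨h1, h2⟩
      obtain ⟨j, rfl⟩ : ∃ j : Fin n, i = j + 1 := ⟨⟨i - 1, by omega⟩, by simp only []; omega⟩
      rw [hpv] at h2
      exact ⟨j, by rw [Fin.lt_def]; omega, rfl⟩
    · rintro ⟨j, hj, rfl⟩
      rw [hpv]
      rw [Fin.lt_def] at hj
      omega
  have hfix : fixStat σ = (Finset.univ.filter fun j => σ j = j).card := by
    rw [fixStat, ← Finset.card_image_of_injOn (hinj _)]
    congr 1
    ext i
    simp only [Finset.mem_filter, Finset.mem_Icc, Finset.mem_image, Finset.mem_univ, true_and]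
    constructor
    · rintro ⟨h1, h2⟩
      obtain ⟨j, rfl⟩ : ∃ j : Fin n, i = j + 1 := ⟨⟨i - 1, by omega⟩, by simp only []; omega⟩
      rw [hpv] at h2
      exact ⟨j, Fin.ext (by omega), rfl⟩
    · rintro ⟨j, hj, rfl⟩
      rw [hpv, hj]
      omega
  have hw (j : Fin n) : typeWeight r t (cmp (σ j) j) =
      (if j < σ j then t else 1) * if σ j = j then r else 1 := by
    rcases lt_trichotomy (σ j) j with h | h | h
    · rw [(cmp_eq_lt_iff _ _).2 h, if_neg h.not_gt, if_neg h.ne, typeWeight, mul_one]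
    · rw [(cmp_eq_eq_iff _ _).2 h, if_neg h.not_gt, if_pos h, typeWeight, one_mul]
    · rw [(cmp_eq_gt_iff _ _).2 h, if_pos h, if_neg h.ne', typeWeight, mul_one]
  simp only [hw, Finset.prod_mul_distrib, hexc, hfix, ← Finset.prod_filter, Finset.prod_const]

theorem coeff_pow_eq_sum_antidiagonalTuple {R : Type*} [CommSemiring R] (G : PowerSeries R)
    (m n : ℕ) : PowerSeries.coeff n (G ^ m) =
      ∑ c ∈ Finset.Nat.antidiagonalTuple m n, ∏ i, PowerSeries.coeff (c i) G := by
  induction m generalizing n with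
  | zero => rcases n with _ | n <;> simp [PowerSeries.coeff_one]
  | succ m ih =>
    rw [sum_antidiagonalTuple_succ, pow_succ', PowerSeries.coeff_mul]
    refine Finset.sum_congr rfl fun p _ => ?_
    rw [ih, Finset.mul_sum]
    refine Finset.sum_congr rfl fun c _ => ?_
    rw [Fin.prod_univ_succ, Fin.cons_zero]
    simp only [Fin.cons_succ]

theorem coeff_mul_pow_eq_sum_antidiagonalTuple {R : Type*} [CommSemiring R]
    (f G : PowerSeries R) (m n : ℕ) : PowerSeries.coeff n (f * G ^ m) =
      ∑ c ∈ Finset.Nat.antidiagonalTuple (m + 1) n, PowerSeries.coeff (c 0) f *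
        ∏ i : Fin m, PowerSeries.coeff (c i.succ) G := by
  rw [sum_antidiagonalTuple_succ, PowerSeries.coeff_mul]
  refine Finset.sum_congr rfl fun p _ => ?_
  rw [coeff_pow_eq_sum_antidiagonalTuple, Finset.mul_sum]
  simp only [Fin.cons_zero, Fin.cons_succ]

theorem coeff_eq_sum_of_mul_one_sub {R : Type*} [CommRing R] {a e G : PowerSeries R} (c : R)
    (h : a * (1 - PowerSeries.C c * (PowerSeries.X ^ 2 * G)) = e) (n : ℕ) :
    PowerSeries.coeff n a = ∑ m ∈ Finset.range (n / 2 + 1),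
      c ^ m * PowerSeries.coeff n (e * (PowerSeries.X ^ 2 * G) ^ m) := by
  have h1 : a = e * ∑ m ∈ Finset.range (n / 2 + 1),
      (PowerSeries.C c * (PowerSeries.X ^ 2 * G)) ^ m + PowerSeries.X ^ (2 * (n / 2 + 1)) *
        (a * (PowerSeries.C c * G) ^ (n / 2 + 1)) := by
    rw [← h, mul_assoc, mul_neg_geom_sum]
    ring
  conv_lhs => rw [h1]
  rw [map_add, PowerSeries.coeff_X_pow_mul', if_neg (by omega), add_zero, Finset.mul_sum, map_sum]
  refine Finset.sum_congr rfl fun m _ => ?_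
  rw [mul_pow, ← map_pow, mul_left_comm, PowerSeries.coeff_C_mul]

theorem algebraMap_K_injective : Function.Injective (algebraMap (MvPolynomial (Fin 3) ℤ) K) :=
  IsFractionRing.injective _ _

theorem qv_ne_zero : qv ≠ 0 := by
  rw [qv, Ne, map_eq_zero_iff _ algebraMap_K_injective]
  exact MvPolynomial.X_ne_zero 0

theorem qv_pow_succ_ne_one (k : ℕ) : qv ^ (k + 1) ≠ 1 := by
  rw [qv, ← map_pow, ← map_one (algebraMap (MvPolynomial (Fin 3) ℤ) K)]
  intro h
  simpa using congrArg (MvPolynomial.eval 0) (algebraMap_K_injective h)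

theorem one_sub_tv_mul_qv_ne_zero : 1 - tv * qv ≠ 0 := by
  rw [qv, tv, ← map_mul, ← map_one (algebraMap (MvPolynomial (Fin 3) ℤ) K), ← map_sub, Ne,
    map_eq_zero_iff _ algebraMap_K_injective]
  intro h
  simpa using congrArg (MvPolynomial.eval 0) h

theorem one_sub_mul_qInt (x : K) (k : ℕ) : (1 - x) * qInt x k = 1 - x ^ k :=
  mul_neg_geom_sum x k

theorem qPoch_qv (n : ℕ) : qPoch qv n = (1 - qv) ^ n * qFact qv n := by
  rw [qPoch, qFact, ← Finset.card_range n, ← Finset.prod_const, Finset.card_range,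
    ← Finset.prod_mul_distrib]
  simp only [one_sub_mul_qInt]

theorem qFact_qv_ne_zero (n : ℕ) : qFact qv n ≠ 0 :=
  Finset.prod_ne_zero_iff.2 fun k _ hk => by
    have := one_sub_mul_qInt qv (k + 1)
    rw [hk, mul_zero] at this
    exact qv_pow_succ_ne_one k (sub_eq_zero.1 this.symm).symm

theorem pow_sub_self_eq (x : K) (j : ℕ) :
    x ^ j - x = (1 - x) * ((if j = 0 then 1 else 0) - x * qInt x (j - 1)) := by
  rcases j with _ | j
  · simp [qInt]
  · have := one_sub_mul_qInt x j
    rw [if_neg (Nat.succ_ne_zero j), Nat.add_sub_cancel, pow_succ]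
    linear_combination x * this

/-- The `q`-exponential generating function of `x`. -/
def qExpSeries (x : ℕ → K) : PowerSeries K := PowerSeries.mk fun n => x n / qFact qv n

theorem qExpSeries_majCount_mul :
    qExpSeries (majCount qv rv tv) * (1 - PowerSeries.C (tv * qv) *
      qExpSeries fun k => qInt (tv * qv) (k - 1)) = qExpSeries fun n => rv ^ n := by
  ext n
  have h := sum_majCount qv_ne_zero qv_pow_succ_ne_one rv tv n
  have hq1 : (1 - qv) ^ n ≠ 0 := pow_ne_zero _ (sub_ne_zero.2 fun h => qv_pow_succ_ne_one 0
    (by rw [zero_add, pow_one, ← h]))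
  have h1 := one_sub_tv_mul_qv_ne_zero
  refine mul_left_cancel₀ (div_ne_zero h1 hq1) ?_
  rw [PowerSeries.coeff_mul, Finset.mul_sum]
  convert h using 1
  · refine Finset.sum_congr rfl fun p hp => ?_
    obtain rfl := Finset.HasAntidiagonal.mem_antidiagonal.1 hp
    rw [pow_sub_self_eq, qPoch_qv, qPoch_qv, map_sub, PowerSeries.coeff_C_mul,
      PowerSeries.coeff_one]
    simp only [qExpSeries, PowerSeries.coeff_mk]
    have h2 := qFact_qv_ne_zero p.1
    have h3 := qFact_qv_ne_zero p.2
    have h4 : (if p.2 = 0 then (1 : K) else 0) * qFact qv p.2 = if p.2 = 0 then 1 else 0 := by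
      split_ifs with h
      · simp [h, qFact]
      · simp
    rw [pow_add] at hq1 ⊢
    have h5 := left_ne_zero_of_mul hq1
    have h6 := right_ne_zero_of_mul hq1
    revert h4
    generalize (if p.2 = 0 then (1 : K) else 0) = i
    intro h4
    field_simp
    linear_combination majCount qv rv tv p.1 * h4
  · rw [qPoch_qv]
    simp only [qExpSeries, PowerSeries.coeff_mk]
    have h2 := qFact_qv_ne_zero n
    field_simp

theorem qExpSeries_qInt_eq (x : K) : (qExpSeries fun k => qInt x (k - 1)) = PowerSeries.X ^ 2 *
    PowerSeries.mk fun k => qInt x (k + 1) / qFact qv (k + 2) := by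
  ext k
  rcases k with _ | _ | k
  · simp [qExpSeries, qInt]
  · simp [qExpSeries, qInt, PowerSeries.coeff_X_pow_mul']
  · rw [PowerSeries.coeff_X_pow_mul', if_pos (by omega)]
    simp [qExpSeries]

theorem fixed_point_version (n : ℕ) :
    ∑ σ : Equiv.Perm (Fin n), qv ^ maj σ * tv ^ exc σ * rv ^ fixStat σ =
      ∑ m ∈ Finset.range (n / 2 + 1), (tv * qv) ^ m *
        ∑ k ∈ (Finset.Nat.antidiagonalTuple (m + 1) n).filter
            (fun k : Fin (m + 1) → ℕ => ∀ i : Fin (m + 1), 1 ≤ i.val → 2 ≤ k i),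
          qMultinomial n k * rv ^ k 0 * ∏ i : Fin m, qInt (tv * qv) (k i.succ - 1) := by
  have hA : ∑ σ : Equiv.Perm (Fin n), qv ^ maj σ * tv ^ exc σ * rv ^ fixStat σ =
      majCount qv rv tv n := by
    refine Finset.sum_congr rfl fun σ _ => ?_
    rw [prod_typeWeight]
    ring
  have h := qExpSeries_majCount_mul
  rw [qExpSeries_qInt_eq] at h
  have h' := coeff_eq_sum_of_mul_one_sub _ h n
  rw [qExpSeries, PowerSeries.coeff_mk, div_eq_iff (qFact_qv_ne_zero n), Finset.sum_mul,
    ← qExpSeries_qInt_eq] at h'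
  rw [hA, h']
  refine Finset.sum_congr rfl fun m _ => ?_
  rw [mul_assoc, coeff_mul_pow_eq_sum_antidiagonalTuple, Finset.sum_filter, Finset.sum_mul]
  congr 1
  refine Finset.sum_congr rfl fun k _ => ?_
  split_ifs with hk
  · simp only [qExpSeries, PowerSeries.coeff_mk, qMultinomial, Finset.prod_div_distrib]
    rw [Fin.prod_univ_succ]
    ring
  · push Not at hk
    obtain ⟨i, hi, hki⟩ := hk
    obtain ⟨j, rfl⟩ : ∃ j : Fin m, i = j.succ := Fin.eq_succ_of_ne_zero (by rintro rfl; simp at hi)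
    have hk0 : k j.succ - 1 = 0 := by omega
    rw [Finset.prod_eq_zero (Finset.mem_univ j), mul_zero, zero_mul]
    simp [qExpSeries, hk0, qInt]

end
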